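/- arXiv:1004.1058 — 13 statements merged into one kernel-verified Lean document; each statement's English description precedes it below -/
import Mathlib

section
/- Let λ₀, λ₁, …, λ_β be the β+1 distinct complex roots of λ^{β+1} − λ^β − σ = 0. Then for every i ≥ 0, Z_i = Σ_{j=0}^β c_j · λ_j^i, where c_j = λ_j^{β+1} / ((β+1)λ_j − β). -/
/-- The partition function `Z_i`, defined by the recursion
`Z_i = 1 + i·σ` for `0 ≤ i ≤ β+1` and `Z_i = Z_{i-1} + σ·Z_{i-β-1}` for `i ≥ β+2`. -/
noncomputable def Zrec (β : ℕ) (σ : ℝ) : ℕ → ℝ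
  | i =>
    if h : i ≤ β + 1 then 1 + i * σ
    else Zrec β σ (i - 1) + σ * Zrec β σ (i - β - 1)
  decreasing_by
  · omega
  · omega

open Polynomial Finset in
/-- A monic polynomial of degree `#s` vanishing at `#s` distinct nodes is their nodal polynomial. -/
theorem Polynomial.Monic.nodal_eq_of_eval_eq_zero {F ι : Type*} [Field F] {s : Finset ι} {v : ι → F}
    (hv : Set.InjOn v s) {p : F[X]} (hp : p.Monic) (hdeg : p.natDegree = #s)
    (hroot : ∀ i ∈ s, p.eval (v i) = 0) : Lagrange.nodal s v = p := by
  refine eq_of_degree_le_of_eval_index_eq s hv Lagrange.degree_nodal.le ?_ ?_ fun i hi ↦ ?_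
  · rw [Lagrange.degree_nodal, degree_eq_natDegree hp.ne_zero, hdeg]
  · rw [Lagrange.nodal_monic.leadingCoeff, hp.leadingCoeff]
  · rw [Lagrange.eval_nodal_at_node hi, hroot i hi]

open Polynomial Finset in
/-- Euler's formula for the sums `∑ λ ^ k / p'(λ)` over the roots of a monic polynomial
with distinct roots. -/
theorem Polynomial.Monic.sum_pow_div_eval_derivative {F ι : Type*} [Field F] {s : Finset ι}
    {v : ι → F} (hv : Set.InjOn v s) {p : F[X]} (hp : p.Monic) (hdeg : p.natDegree = #s)
    (hroot : ∀ i ∈ s, p.eval (v i) = 0) {k : ℕ} (hk : k < #s) :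
    ∑ i ∈ s, v i ^ k / p.derivative.eval (v i) = if k + 1 = #s then 1 else 0 := by
  classical
  have hcoeff := Lagrange.coeff_eq_sum hv (P := X ^ k) (by rw [degree_X_pow]; exact_mod_cast hk)
  rw [coeff_X_pow] at hcoeff
  have hiff : k + 1 = #s ↔ #s - 1 = k := by omega
  simp only [hiff, hcoeff, eval_pow, eval_X]
  refine sum_congr rfl fun i hi ↦ ?_
  rw [← hp.nodal_eq_of_eval_eq_zero hv hdeg hroot,
    Lagrange.eval_nodal_derivative_eval_node_eq hi, Lagrange.eval_nodal]

/-- The sequence with impulse initial data satisfying the recursion of `Zrec` from the start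
is `Zrec` delayed by `2 * β` steps. -/
theorem Zrec_eq_of_recurrence {β : ℕ} {σ : ℝ} {T : ℕ → ℂ}
    (hrec : ∀ k, T (k + β + 1) = T (k + β) + σ * T k)
    (hzero : ∀ k < β, T k = 0) (hone : T β = 1) (i : ℕ) :
    (Zrec β σ i : ℂ) = T (2 * β + i) := by
  have hconst : ∀ m ≤ β, T (β + m) = 1 := by
    intro m
    induction m with
    | zero => simpa using hone
    | succ m ih =>
      intro hm
      rw [← add_assoc, add_comm β m, hrec, hzero m (by omega), add_comm m β, ih (by omega)]
      simp
  have hlin : ∀ m ≤ β + 1, T (2 * β + m) = 1 + m * σ := by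
    intro m
    induction m with
    | zero => simpa [two_mul] using hconst β le_rfl
    | succ m ih =>
      intro hm
      have h := hrec (β + m)
      rw [show β + m + β = 2 * β + m by ring, ih (by omega), hconst m (by omega)] at h
      rw [← add_assoc, h]
      push_cast
      ring
  induction i using Nat.strong_induction_on with
  | _ i ih =>
    rw [Zrec]
    split_ifs with h
    · rw [hlin i h]
      push_cast
      rfl
    · push_cast
      rw [ih (i - 1) (by omega), ih (i - β - 1) (by omega)]
      have hT := hrec (2 * β + (i - β - 1))
      rw [show 2 * β + (i - β - 1) + β + 1 = 2 * β + i by omega,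
        show 2 * β + (i - β - 1) + β = 2 * β + (i - 1) by omega] at hT
      exact hT.symm

open Polynomial in
/-- If `λ₀, λ₁, …, λ_β` enumerate the `β+1` distinct complex roots of
`λ^{β+1} − λ^β − σ = 0`, then for every `i ≥ 0`,
`Z_i = Σ_{j=0}^β c_j · λ_j^i` with `c_j = λ_j^{β+1} / ((β+1)λ_j − β)`. -/
theorem partition_partial_fraction (β : ℕ) (hβ : 1 ≤ β) (σ : ℝ) (hσ : 0 < σ)
    (lam : Fin (β + 1) → ℂ) (hinj : Function.Injective lam)
    (hroot : ∀ j, lam j ^ (β + 1) - lam j ^ β - (σ : ℂ) = 0) :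
    ∀ i : ℕ, (Zrec β σ i : ℂ) =
      ∑ j : Fin (β + 1),
        (lam j ^ (β + 1) / (((β : ℂ) + 1) * lam j - (β : ℂ))) * lam j ^ i := by
  intro i
  set p : ℂ[X] := X ^ (β + 1) - X ^ β - C (σ : ℂ) with hp
  have hlow : (X ^ β + C (σ : ℂ)).degree < ((β + 1 : ℕ) : WithBot ℕ) := by
    rw [degree_X_pow_add_C (by omega)]
    exact_mod_cast β.lt_succ_self
  have hp' : p = X ^ (β + 1) - (X ^ β + C (σ : ℂ)) := by rw [hp]; ring
  have hmonic : p.Monic := hp' ▸ monic_X_pow_sub (by simpa using hlow)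
  have hdeg : p.natDegree = β + 1 := by
    rw [hp', natDegree_eq_of_degree_eq_some]
    rw [degree_sub_eq_left_of_degree_lt (by simpa using hlow), degree_X_pow]
  have heuler (k : ℕ) (hk : k < β + 1) := hmonic.sum_pow_div_eval_derivative
    (s := Finset.univ) hinj.injOn (by simpa using hdeg)
    (fun j _ ↦ by simpa [hp] using hroot j) (k := k) (by simpa using hk)
  have hne : ∀ j, lam j ≠ 0 := by
    intro j hj
    have h := hroot j
    rw [hj, zero_pow (by omega), zero_pow (by omega)] at h
    simp [hσ.ne'] at h
  rw [Zrec_eq_of_recurrence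
    (T := fun k ↦ ∑ j, lam j ^ k / p.derivative.eval (lam j)) ?_ ?_ ?_ i]
  · refine Finset.sum_congr rfl fun j _ ↦ ?_
    obtain ⟨b, rfl⟩ := Nat.exists_eq_add_of_le' hβ
    have hder : p.derivative.eval (lam j) =
        lam j ^ b * (((b + 1 : ℕ) + 1) * lam j - (b + 1 : ℕ)) := by
      simp [hp]
      ring
    rw [hder, show 2 * (b + 1) + i = b + (b + 1 + 1 + i) by ring, pow_add (lam j) b,
      mul_div_mul_left _ _ (pow_ne_zero b (hne j)), pow_add (lam j) _ i, div_mul_eq_mul_div]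
  · intro k
    simp only [Finset.mul_sum, ← Finset.sum_add_distrib]
    refine Finset.sum_congr rfl fun j _ ↦ ?_
    rw [← mul_div_assoc, ← add_div]
    congr 1
    linear_combination lam j ^ k * hroot j
  · intro k hk
    simpa [hk.ne] using heuler k (by omega)
  · simpa using heuler β (by omega)
end

section
/- Let β ≥ 1 and η ≥ 1 be integers and σ > 0. Define the finite-network throughput θ_n(β,η,σ) = σ · Z_{n−max(β,η−1)} · Z_{n−max(β,η+1)} / Z_{2n+1} for n ≥ max(β,η+1). Then lim_{n→∞} θ_n(β,η,σ) = σ · λ₀^{β−f(β)} / ((β+1)λ₀ − β), where λ₀ is the unique positive real root of λ^{β+1} − λ^β − σ = 0 and f(β) = 2η if 0 ≤ β ≤ η−1, f(β) = η+β+1 if η−1 ≤ β ≤ η+1, and f(β) = 2β if β ≥ η+1. -/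
/-- `f(β) = 2η` if `β ≤ η−1`, `f(β) = η+β+1` if `η−1 ≤ β ≤ η+1`, `f(β) = 2β` if `β ≥ η+1`. -/
def fval (η β : ℕ) : ℤ :=
  if β ≤ η - 1 then 2 * (η : ℤ) else if β ≤ η + 1 then (η : ℤ) + β + 1 else 2 * (β : ℤ)

section Averaging

variable {β : ℕ} {p : ℝ} {v : ℕ → ℝ}

theorem le_of_averaging_recurrence (hp0 : 0 ≤ p) (hp1 : p ≤ 1)
    (hrec : ∀ n, v (n + β + 1) = p * v (n + β) + (1 - p) * v n) {b : ℝ}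
    (hb : ∀ k ≤ β, v k ≤ b) (n : ℕ) : v n ≤ b := by
  induction n using Nat.strong_induction_on with
  | _ n ih =>
    by_cases hn : n ≤ β
    · exact hb n hn
    · obtain ⟨m, rfl⟩ : ∃ m, n = m + β + 1 := ⟨n - β - 1, by omega⟩
      have h1 := ih (m + β) (by omega)
      have h2 := ih m (by omega)
      rw [hrec]
      nlinarith

/-- A weighted sum over a window vanishes, so the window has a nonpositive entry; averaging
propagates the gain. -/
theorem le_contracted_of_averaging_recurrence (hp0 : 0 ≤ p) (hp1 : p ≤ 1)
    (hrec : ∀ n, v (n + β + 1) = p * v (n + β) + (1 - p) * v n)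
    (hsum : ∀ n, v (n + β) + (1 - p) * ∑ k ∈ Finset.range β, v (n + k) = 0)
    {b : ℝ} (hb0 : 0 ≤ b) {n : ℕ} (hb : ∀ m ≥ n, v m ≤ b) {m : ℕ} (hm : n + 2 * β ≤ m) :
    v m ≤ (1 - p ^ β) * b := by
  obtain ⟨j, hj, hvj⟩ : ∃ j ≤ β, v (m - β + j) ≤ 0 := by
    by_contra! hpos
    have h1 := hpos β le_rfl
    have h2 : 0 ≤ ∑ k ∈ Finset.range β, v (m - β + k) :=
      Finset.sum_nonneg fun k hk => (hpos k (Finset.mem_range.1 hk).le).le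
    have h3 := mul_nonneg (sub_nonneg.2 hp1) h2
    linarith [hsum (m - β)]
  have hstep : ∀ k, v (m - β + j + k) ≤ (1 - p ^ k) * b := by
    intro k
    induction k with
    | zero => simpa using hvj
    | succ k ih =>
      obtain ⟨l, hl⟩ : ∃ l, m - β + j + k = l + β := ⟨m - β + j + k - β, by omega⟩
      have h1 := hb l (by omega)
      rw [← add_assoc, hl, hrec, ← hl]
      have h2 := mul_le_mul_of_nonneg_left ih hp0
      have h3 := mul_le_mul_of_nonneg_left h1 (sub_nonneg.2 hp1)
      calc _ ≤ p * ((1 - p ^ k) * b) + (1 - p) * b := add_le_add h2 h3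
        _ = _ := by ring
  have h := hstep (β - j)
  rw [show m - β + j + (β - j) = m by omega] at h
  have h4 : p ^ β ≤ p ^ (β - j) := pow_le_pow_of_le_one hp0 hp1 (Nat.sub_le _ _)
  nlinarith

theorem tendsto_zero_of_averaging_recurrence (hβ : 1 ≤ β) (hp0 : 0 < p) (hp1 : p ≤ 1)
    (hrec : ∀ n, v (n + β + 1) = p * v (n + β) + (1 - p) * v n)
    (hsum : ∀ n, v (n + β) + (1 - p) * ∑ k ∈ Finset.range β, v (n + k) = 0) :
    Filter.Tendsto v Filter.atTop (nhds 0) := by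
  have hrec' : ∀ n, (-v) (n + β + 1) = p * (-v) (n + β) + (1 - p) * (-v) n := by
    intro n
    simp only [Pi.neg_apply, hrec]
    ring
  have hsum' : ∀ n, (-v) (n + β) + (1 - p) * ∑ k ∈ Finset.range β, (-v) (n + k) = 0 := by
    intro n
    simp only [Pi.neg_apply, Finset.sum_neg_distrib]
    linarith [hsum n]
  set b := ∑ k ∈ Finset.range (β + 1), |v k|
  have hb0 : 0 ≤ b := Finset.sum_nonneg fun _ _ => abs_nonneg _
  have hbk : ∀ k ≤ β, |v k| ≤ b := fun k hk =>
    Finset.single_le_sum (f := fun k => |v k|) (fun _ _ => abs_nonneg _)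
      (Finset.mem_range.2 (by omega))
  have hr0 : 0 ≤ 1 - p ^ β := sub_nonneg.2 (pow_le_one₀ hp0.le hp1)
  have hr1 : 1 - p ^ β < 1 := sub_lt_self _ (pow_pos hp0 _)
  have hdecay : ∀ k m, 2 * β * k ≤ m → |v m| ≤ (1 - p ^ β) ^ k * b := by
    intro k
    induction k with
    | zero =>
      intro m _
      rw [pow_zero, one_mul, abs_le']
      exact ⟨le_of_averaging_recurrence hp0.le hp1 hrec
          (fun k hk => (le_abs_self _).trans (hbk k hk)) m,
        le_of_averaging_recurrence hp0.le hp1 hrec'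
          (fun k hk => (neg_le_abs _).trans (hbk k hk)) m⟩
    | succ k ih =>
      intro m hm
      have hbound : 0 ≤ (1 - p ^ β) ^ k * b := mul_nonneg (pow_nonneg hr0 _) hb0
      have hm' : 2 * β * k + 2 * β ≤ m := by linarith
      rw [pow_succ', mul_assoc, abs_le']
      exact ⟨le_contracted_of_averaging_recurrence hp0.le hp1 hrec hsum hbound
          (fun l hl => (le_abs_self _).trans (ih l hl)) hm',
        le_contracted_of_averaging_recurrence hp0.le hp1 hrec' hsum' hbound
          (fun l hl => (neg_le_abs _).trans (ih l hl)) hm'⟩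
  have hlim : Filter.Tendsto (fun m : ℕ => (1 - p ^ β) ^ (m / (2 * β)) * b)
      Filter.atTop (nhds 0) := by
    have h := ((tendsto_pow_atTop_nhds_zero_of_lt_one hr0 hr1).comp
      (Nat.tendsto_div_const_atTop (show 2 * β ≠ 0 by omega))).mul_const b
    rwa [zero_mul] at h
  exact squeeze_zero_norm (fun m => hdecay _ m (Nat.mul_div_le m _)) hlim

end Averaging

theorem Zrec_of_le {β i : ℕ} (σ : ℝ) (h : i ≤ β + 1) : Zrec β σ i = 1 + i * σ := by
  rw [Zrec, dif_pos h]

theorem Zrec_add (β : ℕ) (σ : ℝ) (n : ℕ) :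
    Zrec β σ (n + β + 1) = Zrec β σ (n + β) + σ * Zrec β σ n := by
  rcases Nat.eq_zero_or_pos n with rfl | hn
  · rw [Zrec_of_le σ (by omega), Zrec_of_le σ (by omega), Zrec_of_le σ (by omega)]
    push_cast
    ring
  · rw [Zrec, dif_neg (by omega), show n + β + 1 - 1 = n + β by omega,
      show n + β + 1 - β - 1 = n by omega]

/-- The growth rate of the partition function is the root of the characteristic polynomial. -/
theorem tendsto_Zrec_div_pow {β : ℕ} (hβ : 1 ≤ β) {σ lam : ℝ} (hlam : 1 < lam)
    (hroot : σ = lam ^ β * (lam - 1)) :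
    Filter.Tendsto (fun n => Zrec β σ n / lam ^ n) Filter.atTop
      (nhds (lam ^ (β + 1) / ((β + 1) * lam - β))) := by
  have hlam0 : lam ≠ 0 := by positivity
  have hden : ((β : ℝ) + 1) * lam - β ≠ 0 := by
    have : (0 : ℝ) ≤ β := Nat.cast_nonneg β
    nlinarith
  set C := lam ^ (β + 1) / ((β + 1) * lam - β) with hC
  set p := lam⁻¹ with hp
  have hp0 : 0 < p := by positivity
  have hp1 : p < 1 := inv_lt_one_of_one_lt₀ hlam
  set u : ℕ → ℝ := fun n => Zrec β σ n / lam ^ n with hu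
  have hrec : ∀ n, u (n + β + 1) = p * u (n + β) + (1 - p) * u n := by
    intro n
    simp only [hu, Zrec_add, hp]
    rw [hroot]
    field_simp
    ring
  have hpartial : ∀ m ≤ β, (1 - p) * (u m + (1 - p) * ∑ k ∈ Finset.range m, u k)
      = (1 - p) + σ * p * (1 - p ^ m) := by
    intro m
    induction m with
    | zero => simp [hu, Zrec_of_le]
    | succ m ih =>
      intro hm
      have h := ih (by omega)
      have h1 : u m = (1 + m * σ) * p ^ m := by
        simp only [hu, hp, Zrec_of_le σ (show m ≤ β + 1 by omega), inv_pow, div_eq_mul_inv]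
      have h2 : u (m + 1) = (1 + (m + 1) * σ) * p ^ (m + 1) := by
        simp only [hu, hp, Zrec_of_le σ (show m + 1 ≤ β + 1 by omega), inv_pow, div_eq_mul_inv]
        push_cast
        rfl
      rw [Finset.sum_range_succ, h2, h1]
      rw [h1] at h
      linear_combination h
  have hcons : ∀ n, u (n + β) + (1 - p) * ∑ k ∈ Finset.range β, u (n + k) = lam ^ β := by
    intro n
    induction n with
    | zero =>
      have h := hpartial β le_rfl
      have hq : (1 - p) ≠ 0 := (sub_pos.2 hp1).ne'
      simp only [zero_add]
      apply mul_left_cancel₀ hq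
      rw [h, hroot, hp, inv_pow]
      field_simp
      ring
    | succ n ih =>
      have h1 := Finset.sum_range_succ (fun k => u (n + k)) β
      have h2 := Finset.sum_range_succ' (fun k => u (n + k)) β
      have h3 : ∑ k ∈ Finset.range β, u (n + 1 + k) = ∑ k ∈ Finset.range β, u (n + (k + 1)) :=
        Finset.sum_congr rfl fun k _ => by rw [add_assoc, add_comm 1 k]
      rw [add_zero] at h2
      rw [show n + 1 + β = n + β + 1 by omega, hrec, h3]
      linear_combination ih + (1 - p) * h1 - (1 - p) * h2
  have hCval : C + (1 - p) * (β * C) = lam ^ β := by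
    rw [hC, hp]
    field_simp
    ring
  have hlim : Filter.Tendsto (fun n => u n - C) Filter.atTop (nhds 0) := by
    refine tendsto_zero_of_averaging_recurrence hβ hp0 hp1.le (fun n => ?_) (fun n => ?_)
    · rw [hrec]
      ring
    · rw [Finset.sum_sub_distrib, Finset.sum_const, Finset.card_range, nsmul_eq_mul]
      linear_combination hcons n - hCval
  simpa using hlim.add_const C

theorem fval_eq_max_add_max {η : ℕ} (hη : 1 ≤ η) (β : ℕ) :
    fval η β = ((max β (η - 1) + max β (η + 1) : ℕ) : ℤ) := by
  unfold fval
  split_ifs <;> omega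

/-- The finite-network throughput
`θ_n(β,η,σ) = σ · Z_{n−max(β,η−1)} · Z_{n−max(β,η+1)} / Z_{2n+1}` converges, as `n → ∞`, to
`σ · λ₀^{β−f(β)} / ((β+1)λ₀ − β)`, where `λ₀` is the unique positive real root of
`λ^{β+1} − λ^β − σ = 0`. -/
theorem throughput_limit (β η : ℕ) (hβ : 1 ≤ β) (hη : 1 ≤ η) (σ : ℝ) (hσ : 0 < σ)
    (lam0 : ℝ) (hlam0 : 0 < lam0) (hroot : lam0 ^ (β + 1) - lam0 ^ β - σ = 0) :
    Filter.Tendsto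
      (fun n : ℕ =>
        σ * Zrec β σ (n - max β (η - 1)) * Zrec β σ (n - max β (η + 1)) /
          Zrec β σ (2 * n + 1))
      Filter.atTop
      (nhds (σ * lam0 ^ ((β : ℤ) - fval η β) / ((β + 1) * lam0 - β))) := by
  have hfac : σ = lam0 ^ β * (lam0 - 1) := by linear_combination -hroot
  have hlam1 : 1 < lam0 := by
    have h : 0 < lam0 ^ β * (lam0 - 1) := hfac ▸ hσ
    linarith [(pos_iff_pos_of_mul_pos h).1 (pow_pos hlam0 β)]
  have hlam : lam0 ≠ 0 := hlam0.ne'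
  have hden : ((β : ℝ) + 1) * lam0 - β ≠ 0 := by
    have : (0 : ℝ) ≤ β := Nat.cast_nonneg β
    nlinarith
  have hu := tendsto_Zrec_div_pow hβ hlam1 hfac
  rw [fval_eq_max_add_max hη]
  set a := max β (η - 1)
  set c := max β (η + 1)
  have hlin : Filter.Tendsto (fun n : ℕ => 2 * n + 1) Filter.atTop Filter.atTop :=
    Filter.tendsto_atTop_mono (fun n => show n ≤ 2 * n + 1 by omega) Filter.tendsto_id
  have hlim := ((((hu.comp (Filter.tendsto_sub_atTop_nat a)).const_mul σ).mul
    (hu.comp (Filter.tendsto_sub_atTop_nat c))).div (hu.comp hlin)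
      (div_ne_zero (pow_ne_zero _ hlam) hden)).mul_const (lam0 ^ (a + c + 1))⁻¹
  have hval : σ * lam0 ^ ((β : ℤ) - ((a + c : ℕ) : ℤ)) / ((β + 1) * lam0 - β)
      = σ * (lam0 ^ (β + 1) / ((β + 1) * lam0 - β)) * (lam0 ^ (β + 1) / ((β + 1) * lam0 - β))
        / (lam0 ^ (β + 1) / ((β + 1) * lam0 - β)) * (lam0 ^ (a + c + 1))⁻¹ := by
    rw [zpow_sub₀ hlam, zpow_natCast, zpow_natCast]
    field_simp
    ring
  rw [hval]
  refine hlim.congr' ?_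
  filter_upwards [Filter.eventually_ge_atTop (a + c)] with n hn
  have hpow : lam0 ^ (2 * n + 1) = lam0 ^ (n - a) * lam0 ^ (n - c) * lam0 ^ (a + c + 1) := by
    rw [← pow_add, ← pow_add]
    congr 1
    omega
  simp only [Pi.div_apply, Function.comp_apply, hpow]
  field_simp
end

section
/- Fix a real σ > 0 and let μ₀(β) = μ₀(β,σ). Then β ↦ μ₀(β) is differentiable on (0,∞) with ∂μ₀/∂β = −μ₀(1+μ₀)ln(1+μ₀) / (1 + μ₀ + β·μ₀); in particular, μ₀(β) is strictly decreasing in β on (0,∞). -/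
theorem strictMonoOn_mul_one_add_rpow {β : ℝ} (hβ : 0 ≤ β) :
    StrictMonoOn (fun x : ℝ => x * (1 + x) ^ β) (Set.Ioi 0) := by
  intro x hx y hy hxy
  have hx0 : 0 < x := hx
  have hy0 : 0 < y := hy
  have hpow : (1 + x) ^ β ≤ (1 + y) ^ β :=
    Real.rpow_le_rpow (by linarith) (by linarith) hβ
  exact mul_lt_mul hxy hpow (Real.rpow_pos_of_pos (by linarith) β) hy0.le

theorem continuous_mul_one_add_rpow_exponent {x : ℝ} (hx : 0 < x) :
    Continuous fun β : ℝ => x * (1 + x) ^ β :=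
  continuous_const.mul (Real.continuous_const_rpow (by linarith))

theorem hasDerivAt_log_sub_log_div_log_one_add {c x : ℝ} (hx : 0 < x) :
    HasDerivAt (fun y : ℝ => (c - Real.log y) / Real.log (1 + y))
      ((-x⁻¹ * Real.log (1 + x) - (c - Real.log x) * (1 / (1 + x))) / Real.log (1 + x) ^ 2) x := by
  have hlog : Real.log (1 + x) ≠ 0 := (Real.log_pos (by linarith)).ne'
  exact ((Real.hasDerivAt_log hx.ne').const_sub c).div
    (((hasDerivAt_id x).const_add 1).log (by simp only [id]; linarith)) hlog

theorem strictAntiOn_of_mul_one_add_rpow_eq {σ : ℝ} {m : ℝ → ℝ}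
    (hm : ∀ β : ℝ, 0 ≤ β → 0 < m β ∧ m β * (1 + m β) ^ β = σ) :
    StrictAntiOn m (Set.Ioi 0) := by
  intro a ha b hb hab
  have ha0 : 0 ≤ a := le_of_lt ha
  obtain ⟨hma, hσa⟩ := hm a ha0
  obtain ⟨hmb, hσb⟩ := hm b (le_of_lt hb)
  refine ((strictMonoOn_mul_one_add_rpow ha0).lt_iff_lt hmb hma).1 ?_
  calc m b * (1 + m b) ^ a < m b * (1 + m b) ^ b :=
        mul_lt_mul_of_pos_left (Real.rpow_lt_rpow_of_exponent_lt (by linarith) hab) hmb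
    _ = m a * (1 + m a) ^ a := hσb.trans hσa.symm

theorem continuousAt_of_mul_one_add_rpow_eq {σ : ℝ} {m : ℝ → ℝ}
    (hm : ∀ β : ℝ, 0 ≤ β → 0 < m β ∧ m β * (1 + m β) ^ β = σ)
    {β : ℝ} (hβ : 0 < β) : ContinuousAt m β := by
  obtain ⟨hmβ, hσβ⟩ := hm β hβ.le
  refine tendsto_order.2 ⟨fun a ha => ?_, fun a ha => ?_⟩
  · rcases le_or_gt a 0 with ha0 | ha0
    · filter_upwards [lt_mem_nhds hβ] with y hy using ha0.trans_lt (hm y hy.le).1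
    · have hlt : a * (1 + a) ^ β < σ :=
        hσβ ▸ strictMonoOn_mul_one_add_rpow hβ.le ha0 hmβ ha
      filter_upwards [lt_mem_nhds hβ,
        (continuous_mul_one_add_rpow_exponent ha0).continuousAt.eventually_lt_const hlt]
        with y hy hya
      obtain ⟨hmy, hσy⟩ := hm y hy.le
      exact ((strictMonoOn_mul_one_add_rpow hy.le).lt_iff_lt ha0 hmy).1 (hya.trans_eq hσy.symm)
  · have ha0 : 0 < a := hmβ.trans ha
    have hlt : σ < a * (1 + a) ^ β :=
      hσβ ▸ strictMonoOn_mul_one_add_rpow hβ.le hmβ ha0 ha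
    filter_upwards [lt_mem_nhds hβ,
      (continuous_mul_one_add_rpow_exponent ha0).continuousAt.eventually_const_lt hlt]
      with y hy hya
    obtain ⟨hmy, hσy⟩ := hm y hy.le
    exact ((strictMonoOn_mul_one_add_rpow hy.le).lt_iff_lt hmy ha0).1 (hσy.trans_lt hya)

theorem log_sub_log_eq_of_mul_one_add_rpow_eq {σ : ℝ} {m : ℝ → ℝ}
    (hm : ∀ β : ℝ, 0 ≤ β → 0 < m β ∧ m β * (1 + m β) ^ β = σ)
    {β : ℝ} (hβ : 0 ≤ β) :
    Real.log σ - Real.log (m β) = β * Real.log (1 + m β) := by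
  obtain ⟨hmβ, hσβ⟩ := hm β hβ
  have h1 : 0 < 1 + m β := by linarith
  rw [← hσβ, Real.log_mul hmβ.ne' (Real.rpow_pos_of_pos h1 β).ne', Real.log_rpow h1]
  ring

/-- Fix `σ > 0` and let `m β = μ₀(β,σ)` be the unique positive solution of
`μ(1+μ)^β = σ`. Then `β ↦ μ₀(β)` is differentiable on `(0,∞)` with
`∂μ₀/∂β = −μ₀(1+μ₀)ln(1+μ₀) / (1 + μ₀ + β·μ₀)`; in particular it is strictly
decreasing on `(0,∞)`. -/
theorem mu0_deriv_beta (σ : ℝ) (hσ : 0 < σ) (m : ℝ → ℝ)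
    (hm : ∀ β : ℝ, 0 ≤ β → 0 < m β ∧ m β * (1 + m β) ^ β = σ) :
    (∀ β : ℝ, 0 < β →
      HasDerivAt m
        (-(m β * (1 + m β) * Real.log (1 + m β)) / (1 + m β + β * m β)) β) ∧
    StrictAntiOn m (Set.Ioi 0) := by
  refine ⟨fun β hβ => ?_, strictAntiOn_of_mul_one_add_rpow_eq hm⟩
  have hmβ := (hm β hβ.le).1
  have h1 : 0 < 1 + m β := by linarith
  have hlog : 0 < Real.log (1 + m β) := Real.log_pos (by linarith)
  have hden : 0 < 1 + m β + β * m β := by positivity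
  have hderiv := hasDerivAt_log_sub_log_div_log_one_add (c := Real.log σ) hmβ
  have hval : (-(m β)⁻¹ * Real.log (1 + m β) - (Real.log σ - Real.log (m β)) * (1 / (1 + m β))) /
      Real.log (1 + m β) ^ 2 =
      -((1 + m β + β * m β) / (m β * (1 + m β) * Real.log (1 + m β))) := by
    rw [log_sub_log_eq_of_mul_one_add_rpow_eq hm hβ.le]
    field_simp
    ring
  rw [hval] at hderiv
  have hinv := hderiv.of_local_left_inverse (continuousAt_of_mul_one_add_rpow_eq hm hβ)
    (neg_ne_zero.2 (by positivity)) (by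
      filter_upwards [lt_mem_nhds hβ] with y hy
      have hy1 := (hm y hy.le).1
      have hlogy : 0 < Real.log (1 + m y) := Real.log_pos (by linarith)
      rw [log_sub_log_eq_of_mul_one_add_rpow_eq hm hy.le, mul_div_cancel_right₀ _ hlogy.ne'])
  rwa [inv_neg, inv_div, ← neg_div] at hinv
end

section
/- Fix an integer η ≥ 1 and a real σ > 0. Then the function β ↦ θ(β,η,σ) is strictly increasing on (0, η−1] (when η ≥ 2) and strictly decreasing on [η+1, ∞). Consequently, any maximizer β* of θ(·,η,σ) over [0,∞) lies in the interval [η−1, η+1]. -/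
/-- `f(β) = 2η` if `0 ≤ β ≤ η−1`, `f(β) = η+β+1` if `η−1 ≤ β ≤ η+1`, `f(β) = 2β` if
`β ≥ η+1`, as a function of a real variable `β`. -/
noncomputable def fR (η : ℕ) (β : ℝ) : ℝ :=
  if β ≤ (η : ℝ) - 1 then 2 * (η : ℝ)
  else if β ≤ (η : ℝ) + 1 then (η : ℝ) + β + 1
  else 2 * β

/-- The limiting throughput `θ(β,η,σ) = σ · λ₀^{β−f(β)} / ((β+1)λ₀ − β)`, where
`λ₀ = 1 + μ₀(β,σ)` and `m β = μ₀(β,σ)`; the power is the real power. -/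
noncomputable def theta (η : ℕ) (σ : ℝ) (m : ℝ → ℝ) (β : ℝ) : ℝ :=
  σ * (1 + m β) ^ (β - fR η β) / ((β + 1) * (1 + m β) - β)

/-- The equilibrium `μ₀(β,σ)` is strictly decreasing in `β`. -/
theorem equilibrium_lt {σ a b u v : ℝ} (ha : 0 ≤ a) (hab : a < b) (hu : 0 < u) (hv : 0 < v)
    (hua : u * (1 + u) ^ a = σ) (hvb : v * (1 + v) ^ b = σ) : v < u := by
  by_contra! h
  have h1 : (1 + u) ^ a ≤ (1 + v) ^ a := Real.rpow_le_rpow (by linarith) (by linarith) ha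
  have h2 : (1 + v) ^ a < (1 + v) ^ b := Real.rpow_lt_rpow_of_exponent_lt (by linarith) hab
  have h3 : u * (1 + u) ^ a < v * (1 + v) ^ b :=
    mul_lt_mul' h (h1.trans_lt h2) (by positivity) hv
  linarith

theorem mul_log_one_add_le {u v : ℝ} (hv : 0 < v) (hvu : v ≤ u) :
    v * Real.log (1 + u) ≤ u * Real.log (1 + v) := by
  have hu : 0 < u := hv.trans_le hvu
  have h : (1 + u) ^ (v / u) ≤ 1 + v / u * u :=
    rpow_one_add_le_one_add_mul_self (by linarith) (by positivity)
      ((div_le_one hu).2 hvu)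
  rw [div_mul_cancel₀ _ hu.ne'] at h
  have h2 := Real.log_le_log (by positivity) h
  rw [Real.log_rpow (by linarith), div_mul_eq_mul_div, div_le_iff₀ hu] at h2
  linarith

/-- The quantity `μ₀ ((β + 1) λ₀ - β)` is strictly decreasing in `β`. -/
theorem equilibrium_mul_denom_lt {σ a b u v : ℝ} (ha : 0 ≤ a) (hab : a < b) (hu : 0 < u)
    (hv : 0 < v) (hua : u * (1 + u) ^ a = σ) (hvb : v * (1 + v) ^ b = σ) :
    v * ((b + 1) * (1 + v) - b) < u * ((a + 1) * (1 + u) - a) := by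
  have hvu := equilibrium_lt ha hab hu hv hua hvb
  have hL : 0 < Real.log (1 + v) := Real.log_pos (by linarith)
  have heq : Real.log v + b * Real.log (1 + v) = Real.log u + a * Real.log (1 + u) := by
    rw [← Real.log_rpow (by linarith), ← Real.log_rpow (by linarith),
      ← Real.log_mul hv.ne' (by positivity), ← Real.log_mul hu.ne' (by positivity), hua, hvb]
  have hconc := mul_le_mul_of_nonneg_left (mul_log_one_add_le hv hvu.le) ha
  have hlog : v * (Real.log u - Real.log v) ≤ u - v := by
    have h := Real.log_le_sub_one_of_pos (div_pos hu hv)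
    rw [Real.log_div hu.ne' hv.ne', div_sub_one hv.ne', le_div_iff₀ hv] at h
    linarith
  have hlow : v ≤ (1 + v) * Real.log (1 + v) := by
    have h := mul_le_mul_of_nonneg_left
      (Real.one_sub_inv_le_log_of_pos (show 0 < 1 + v by linarith)) (show 0 ≤ 1 + v by linarith)
    rw [mul_sub, mul_inv_cancel₀ (by linarith)] at h
    linarith
  have hgap := mul_le_mul_of_nonneg_right hlow (sub_nonneg.2 hvu.le)
  have key : (b * v ^ 2) * Real.log (1 + v) ≤
      (a * u * v + (1 + v) * (u - v)) * Real.log (1 + v) := by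
    have e : (b * v ^ 2) * Real.log (1 + v) =
        v * (a * (v * Real.log (1 + u))) + v * (v * (Real.log u - Real.log v)) := by
      linear_combination v ^ 2 * heq
    rw [e]
    nlinarith [mul_le_mul_of_nonneg_left hconc hv.le, mul_le_mul_of_nonneg_left hlog hv.le]
  have key2 := le_of_mul_le_mul_right key hL
  have h3 : a * u * v ≤ a * u * u := mul_le_mul_of_nonneg_left hvu.le (by positivity)
  nlinarith [mul_lt_mul_of_pos_left hvu hu]

theorem theta_strictMonoOn (η : ℕ) (σ : ℝ) (hσ : 0 < σ) (m : ℝ → ℝ)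
    (hm : ∀ β : ℝ, 0 ≤ β → 0 < m β ∧ m β * (1 + m β) ^ β = σ) :
    StrictMonoOn (theta η σ m) (Set.Icc 0 ((η : ℝ) - 1)) := by
  have form : ∀ β ∈ Set.Icc 0 ((η : ℝ) - 1), theta η σ m β =
      σ ^ 2 / ((1 + m β) ^ (2 * (η : ℝ)) * (m β * ((β + 1) * (1 + m β) - β))) := by
    rintro β ⟨h0, h1⟩
    obtain ⟨hp, he⟩ := hm β h0
    have hD : 0 < (β + 1) * (1 + m β) - β := by nlinarith [mul_nonneg h0 hp.le]
    have hpow : 0 < (1 + m β) ^ (2 * (η : ℝ)) := by positivity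
    rw [theta, fR, if_pos h1, Real.rpow_sub (by linarith)]
    rw [div_eq_div_iff hD.ne' (by positivity), mul_div_assoc', div_mul_eq_mul_div,
      div_eq_iff hpow.ne']
    linear_combination
      σ * (1 + m β) ^ (2 * (η : ℝ)) * ((β + 1) * (1 + m β) - β) * he
  intro a ha b hb hab
  obtain ⟨hu, hua⟩ := hm a ha.1
  obtain ⟨hv, hvb⟩ := hm b hb.1
  rw [form a ha, form b hb]
  have hD : 0 < (b + 1) * (1 + m b) - b := by nlinarith [mul_nonneg hb.1 hv.le]
  have hvu := equilibrium_lt ha.1 hab hu hv hua hvb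
  apply div_lt_div_of_pos_left (by positivity) (by positivity)
  exact mul_lt_mul' (Real.rpow_le_rpow (by linarith) (by linarith) (by positivity))
    (equilibrium_mul_denom_lt ha.1 hab hu hv hua hvb) (by positivity) (by positivity)

theorem theta_strictAntiOn (η : ℕ) (σ : ℝ) (m : ℝ → ℝ)
    (hm : ∀ β : ℝ, 0 ≤ β → 0 < m β ∧ m β * (1 + m β) ^ β = σ) :
    StrictAntiOn (theta η σ m) (Set.Ici ((η : ℝ) + 1)) := by
  have hη : (0 : ℝ) ≤ η := η.cast_nonneg
  have form : ∀ β ∈ Set.Ici ((η : ℝ) + 1), theta η σ m β = 1 / (1 / m β + (β + 1)) := by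
    intro β hβ
    rw [Set.mem_Ici] at hβ
    have h0 : 0 ≤ β := by linarith
    obtain ⟨hp, he⟩ := hm β h0
    have hD : 0 < (β + 1) * (1 + m β) - β := by nlinarith [mul_nonneg h0 hp.le]
    have hf : fR η β = 2 * β := by
      rw [fR, if_neg (by linarith)]
      split_ifs <;> linarith
    have hnum : σ * (1 + m β) ^ (β - 2 * β) = m β := by
      rw [← he, mul_assoc, ← Real.rpow_add (by linarith)]
      ring_nf
      simp
    rw [theta, hf, hnum]
    field_simp
    ring
  intro a ha b hb hab
  rw [form a ha, form b hb]
  rw [Set.mem_Ici] at ha hb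
  obtain ⟨hu, hua⟩ := hm a (by linarith)
  obtain ⟨hv, hvb⟩ := hm b (by linarith)
  have hvu := equilibrium_lt (by linarith) hab hu hv hua hvb
  have hinv := one_div_lt_one_div_of_lt hv hvu
  have hpos : 0 < 1 / m a := by positivity
  exact one_div_lt_one_div_of_lt (by linarith) (by linarith)

/-- `β ↦ θ(β,η,σ)` is strictly increasing on `(0, η−1]` (when `η ≥ 2`) and strictly
decreasing on `[η+1, ∞)`; consequently any maximizer of `θ(·,η,σ)` over `[0,∞)` lies in
`[η−1, η+1]`. -/
theorem optimal_sensing_range_interval (η : ℕ) (hη : 1 ≤ η) (σ : ℝ) (hσ : 0 < σ)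
    (m : ℝ → ℝ)
    (hm : ∀ β : ℝ, 0 ≤ β → 0 < m β ∧ m β * (1 + m β) ^ β = σ) :
    (2 ≤ η → StrictMonoOn (theta η σ m) (Set.Ioc 0 ((η : ℝ) - 1))) ∧
    StrictAntiOn (theta η σ m) (Set.Ici ((η : ℝ) + 1)) ∧
    ∀ βstar : ℝ, 0 ≤ βstar →
      (∀ β : ℝ, 0 ≤ β → theta η σ m β ≤ theta η σ m βstar) →
      (η : ℝ) - 1 ≤ βstar ∧ βstar ≤ (η : ℝ) + 1 := by
  have hmono := theta_strictMonoOn η σ hσ m hm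
  have hanti := theta_strictAntiOn η σ m hm
  refine ⟨fun _ => hmono.mono Set.Ioc_subset_Icc_self, hanti, fun βstar h0 hmax => ⟨?_, ?_⟩⟩
  · by_contra! h
    have h1 : 0 ≤ (η : ℝ) - 1 := h0.trans h.le
    exact (hmax _ h1).not_gt (hmono ⟨h0, h.le⟩ ⟨h1, le_rfl⟩ h)
  · by_contra! h
    exact (hmax _ (by positivity)).not_gt (hanti Set.self_mem_Ici h.le h)
end

section
/- Fix an integer η ≥ 2 and a real σ > 0. For β ∈ (η−1, η+1), the function β ↦ θ(β,η,σ) is differentiable and ∂θ/∂β = (−σ·μ₀·(1+μ₀)^{−η−1} / (1+μ₀+βμ₀)²) · (1 − F(β,σ)), where μ₀ = μ₀(β,σ) and F(β,σ) = (η + 2 + β/(1+μ₀+βμ₀))·ln(1+μ₀). -/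
/-- The map `μ ↦ μ (1 + μ) ^ β` is injective on the positive reals when `β ≥ 0`. -/
lemma mul_one_add_rpow_injOn {β : ℝ} (hβ : 0 ≤ β) :
    Set.InjOn (fun μ : ℝ => μ * (1 + μ) ^ β) (Set.Ioi 0) := by
  refine StrictMonoOn.injOn fun x (hx : 0 < x) y (hy : 0 < y) hxy => ?_
  exact mul_lt_mul hxy (Real.rpow_le_rpow (by linarith) (by linarith) hβ)
    (Real.rpow_pos_of_pos (by linarith) _) hy.le

/-- The exponent `β` recovered from the root `μ` of `μ (1 + μ) ^ β = σ`. -/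
lemma log_sub_log_eq_mul_log {σ μ β : ℝ} (hμ : 0 < μ) (h : μ * (1 + μ) ^ β = σ) :
    Real.log σ - Real.log μ = β * Real.log (1 + μ) := by
  have h1 : 0 < 1 + μ := by linarith
  rw [← h, Real.log_mul hμ.ne' (Real.rpow_pos_of_pos h1 _).ne', Real.log_rpow h1]
  ring

/-- The derivative, by the inverse function theorem, of the root `m β` of
`μ (1 + μ) ^ β = σ`. -/
lemma hasDerivAt_root {σ : ℝ} (hσ : 0 < σ) {m : ℝ → ℝ}
    (hm : ∀ β : ℝ, 0 ≤ β → 0 < m β ∧ m β * (1 + m β) ^ β = σ) {β : ℝ} (hβ : 0 < β) :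
    HasDerivAt m
      (-(m β * (1 + m β) * Real.log (1 + m β)) / (1 + m β + β * m β)) β := by
  obtain ⟨hμ, hroot⟩ := hm β hβ.le
  have hlog := log_sub_log_eq_mul_log hμ hroot
  set μ := m β
  have h1 : 0 < 1 + μ := by linarith
  have hL : 0 < Real.log (1 + μ) := Real.log_pos (by linarith)
  have hD : 0 < 1 + μ + β * μ := by positivity
  let g : ℝ → ℝ := fun x => (Real.log σ - Real.log x) / Real.log (1 + x)
  have hgμ : g μ = β := by simp only [g, hlog]; field_simp
  have hg : HasStrictDerivAt g (-(1 + μ + β * μ) / (μ * (1 + μ) * Real.log (1 + μ))) μ := by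
    have h := (((hasStrictDerivAt_id μ).log hμ.ne').const_sub (Real.log σ)).fun_div
      (((hasStrictDerivAt_id μ).const_add 1).log h1.ne') hL.ne'
    refine h.congr_deriv ?_
    simp only [id, hlog]
    field_simp
    ring
  have hleft : ∀ᶠ x in nhds μ, m (g x) = x := by
    have hpos : ∀ᶠ x in nhds μ, 0 < g x :=
      hg.hasDerivAt.continuousAt.eventually (lt_mem_nhds (by rwa [hgμ]))
    filter_upwards [hpos, lt_mem_nhds hμ] with x hgx hx
    obtain ⟨hp, he⟩ := hm (g x) hgx.le
    refine mul_one_add_rpow_injOn hgx.le hp hx (he.trans ?_)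
    have h1x : 0 < 1 + x := by linarith
    have hLx : Real.log (1 + x) ≠ 0 := (Real.log_pos (by linarith)).ne'
    change σ = x * (1 + x) ^ g x
    rw [Real.rpow_def_of_pos h1x, mul_div_cancel₀ _ hLx, Real.exp_sub, Real.exp_log hσ,
      Real.exp_log hx, mul_div_cancel₀ _ hx.ne']
  have h := (hg.to_local_left_inverse
    (div_ne_zero (neg_ne_zero.2 hD.ne') (by positivity)) hleft).hasDerivAt
  rw [hgμ] at h
  refine h.congr_deriv ?_
  rw [inv_div, neg_div, div_neg]

/-- For `β ∈ (η−1, η+1)` the function `β ↦ θ(β,η,σ)` is differentiable with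
`∂θ/∂β = (−σ·μ₀·(1+μ₀)^{−η−1} / (1+μ₀+βμ₀)²) · (1 − F(β,σ))`, where `μ₀ = μ₀(β,σ)` and
`F(β,σ) = (η + 2 + β/(1+μ₀+βμ₀))·ln(1+μ₀)`. -/
theorem theta_deriv (η : ℕ) (hη : 2 ≤ η) (σ : ℝ) (hσ : 0 < σ) (m : ℝ → ℝ)
    (hm : ∀ β : ℝ, 0 ≤ β → 0 < m β ∧ m β * (1 + m β) ^ β = σ) :
    ∀ β : ℝ, (η : ℝ) - 1 < β → β < (η : ℝ) + 1 →
      HasDerivAt (theta η σ m)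
        ((-(σ * m β) * (1 + m β) ^ (-(η : ℝ) - 1) / (1 + m β + β * m β) ^ 2) *
          (1 - ((η : ℝ) + 2 + β / (1 + m β + β * m β)) * Real.log (1 + m β))) β := by
  intro β hβ₁ hβ₂
  have hη' : (2 : ℝ) ≤ η := by exact_mod_cast hη
  have hβ : 0 < β := by linarith
  have hμ := (hm β hβ.le).1
  have hm' := hasDerivAt_root hσ hm hβ
  have h1 : 0 < 1 + m β := by linarith
  have hD : 0 < 1 + m β + β * m β := by positivity
  have hden : (β + 1) * (1 + m β) - β = 1 + m β + β * m β := by ring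
  have heq : theta η σ m =ᶠ[nhds β] fun b =>
      σ * (1 + m b) ^ (-(η : ℝ) - 1) / ((b + 1) * (1 + m b) - b) := by
    filter_upwards [Ioo_mem_nhds hβ₁ hβ₂] with b hb
    have hf : fR η b = η + b + 1 := by
      rw [fR, if_neg (not_le.2 hb.1), if_pos hb.2.le]
    rw [theta, hf, show b - ((η : ℝ) + b + 1) = -(η : ℝ) - 1 by ring]
  have hnum := ((hm'.const_add 1).rpow_const (p := -(η : ℝ) - 1) (Or.inl h1.ne')).const_mul σ
  have hdiv := hnum.fun_div
    ((((hasDerivAt_id β).add_const 1).fun_mul (hm'.const_add 1)).fun_sub (hasDerivAt_id β))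
    (by simpa only [id, hden] using hD.ne')
  refine HasDerivAt.congr_of_eventuallyEq ?_ heq
  refine hdiv.congr_deriv ?_
  simp only [id, hden]
  rw [Real.rpow_sub_one h1.ne' (-(η : ℝ) - 1)]
  field_simp
  ring
end

section
/- Fix an integer η ≥ 2 and set σ_min = σ(η−1) and σ_max = σ(η+1). Then 0 < σ_min < σ_max, and: (a) if 0 < σ ≤ σ_min, then β ↦ θ(β,η,σ) is strictly decreasing on [η−1, η+1], so its unique maximizer on [η−1,η+1] is β* = η−1; (b) if σ ≥ σ_max, then β ↦ θ(β,η,σ) is strictly increasing on [η−1, η+1], so its unique maximizer is β* = η+1; (c) if σ_min < σ < σ_max, then θ(·,η,σ) attains its maximum on [η−1,η+1] at the unique point β(σ) ∈ (η−1, η+1) satisfying F(β(σ),σ) = 1, θ is strictly increasing at β = η−1 and strictly decreasing at β = η+1, and σ ↦ β(σ) is strictly increasing on (σ_min, σ_max). -/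
/-- The limiting throughput `θ(β,η,σ) = σ · λ₀^{β−f(β)} / ((β+1)λ₀ − β)`, where
`λ₀ = 1 + μ₀(β,σ)` and `m β σ = μ₀(β,σ)` is the unique positive solution of
`μ(1+μ)^β = σ`; the power is the real power. -/
noncomputable def thetaB (η : ℕ) (m : ℝ → ℝ → ℝ) (σ β : ℝ) : ℝ :=
  σ * (1 + m β σ) ^ (β - fR η β) / ((β + 1) * (1 + m β σ) - β)

/-- `F(β,σ) = (η + 2 + β/(1+μ₀+βμ₀))·ln(1+μ₀)` with `μ₀ = m β σ = μ₀(β,σ)`. -/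
noncomputable def Ffun (η : ℕ) (m : ℝ → ℝ → ℝ) (β σ : ℝ) : ℝ :=
  ((η : ℝ) + 2 + β / (1 + m β σ + β * m β σ)) * Real.log (1 + m β σ)

/-- `β` as a function of `p = μ₀`, when `log σ = s`. -/
noncomputable def branch (s p : ℝ) : ℝ := (s - Real.log p) / Real.log (1 + p)

/-- A quantity with the sign of `F - 1` (for `c = η + 2`), monotone in both `β` and `σ`. -/
noncomputable def critGap (c β p : ℝ) : ℝ := c + β / (1 + p + β * p) - 1 / Real.log (1 + p)

/-- `log σ - log θ` along the curve `β = branch s p`. -/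
noncomputable def lossLog (c s p : ℝ) : ℝ :=
  (c - 1) * Real.log (1 + p) + Real.log (1 + p + branch s p * p)

theorem log_one_add_pos {p : ℝ} (hp : 0 < p) : 0 < Real.log (1 + p) :=
  Real.log_pos (by linarith)

theorem log_one_add_lt {p : ℝ} (hp : 0 < p) : Real.log (1 + p) < p := by
  have := Real.log_lt_sub_one_of_pos (x := 1 + p) (by linarith) (by linarith)
  linarith

theorem log_sq_mul_lt_sq {p : ℝ} (hp : 0 < p) : Real.log (1 + p) ^ 2 * (1 + p) < p ^ 2 := by
  have hl := log_one_add_pos hp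
  set l := Real.log (1 + p) with hl_def
  have hs : l / 2 < Real.sinh (l / 2) := Real.self_lt_sinh_iff.2 (by positivity)
  rw [Real.sinh_eq, Real.exp_neg] at hs
  have hu : 0 < Real.exp (l / 2) := Real.exp_pos _
  have hsq : Real.exp (l / 2) ^ 2 = 1 + p := by
    rw [← Real.exp_nat_mul, ← Real.exp_log (show 0 < 1 + p by linarith), ← hl_def]
    congr 1
    push_cast
    ring
  set u := Real.exp (l / 2)
  have hlu : l * u < p := by
    have h1 : l * u < (u - u⁻¹) * u := by
      apply mul_lt_mul_of_pos_right _ hu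
      linarith
    have h2 : (u - u⁻¹) * u = u ^ 2 - 1 := by
      field_simp
    linarith
  calc l ^ 2 * (1 + p) = (l * u) ^ 2 := by rw [← hsq]; ring
    _ < p ^ 2 := by gcongr

theorem hasDerivAt_log_one_add {p : ℝ} (hp : 0 < p) :
    HasDerivAt (fun q : ℝ => Real.log (1 + q)) (1 / (1 + p)) p :=
  ((hasDerivAt_id p).const_add 1).log (by simp only [id]; linarith)

theorem hasDerivAt_branch (s : ℝ) {p : ℝ} (hp : 0 < p) :
    HasDerivAt (branch s)
      (-(1 + p + branch s p * p) / (p * (1 + p) * Real.log (1 + p))) p := by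
  have hl := log_one_add_pos hp
  have h := ((Real.hasDerivAt_log hp.ne').const_sub s).div (hasDerivAt_log_one_add hp) hl.ne'
  refine h.congr_deriv ?_
  unfold branch
  field_simp
  ring

theorem critGap_strictMonoOn (c : ℝ) {β : ℝ} (hβ : 0 ≤ β) :
    StrictMonoOn (critGap c β) (Set.Ioi 0) := by
  have hd : ∀ p ∈ Set.Ioi (0 : ℝ), HasDerivAt (critGap c β)
      (1 / (Real.log (1 + p) ^ 2 * (1 + p)) - β * (1 + β) / (1 + p + β * p) ^ 2) p := by
    intro p hp
    have hp : 0 < p := hp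
    have hl := log_one_add_pos hp
    have hD : 0 < 1 + p + β * p := by positivity
    have h1 : HasDerivAt (fun q : ℝ => 1 + q + β * q) (1 + β) p :=
      (((hasDerivAt_id p).const_add 1).add ((hasDerivAt_id p).const_mul β)).congr_deriv (by ring)
    have h := (((hasDerivAt_const p β).div h1 hD.ne').const_add c).sub
      ((hasDerivAt_const p (1 : ℝ)).div (hasDerivAt_log_one_add hp) hl.ne')
    refine h.congr_deriv ?_
    field_simp
    ring
  refine strictMonoOn_of_deriv_pos (convex_Ioi 0)
    (fun p hp => (hd p hp).continuousAt.continuousWithinAt) fun p hp => ?_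
  rw [interior_Ioi] at hp
  rw [(hd p hp).deriv]
  have hp : 0 < p := hp
  have hl := log_one_add_pos hp
  have hD : 0 < 1 + p + β * p := by positivity
  have hk := log_sq_mul_lt_sq hp
  rw [sub_pos, div_lt_div_iff₀ (by positivity) (by positivity)]
  calc β * (1 + β) * (Real.log (1 + p) ^ 2 * (1 + p)) ≤ β * (1 + β) * p ^ 2 := by gcongr
    _ < 1 * (1 + p + β * p) ^ 2 := by nlinarith [mul_nonneg hβ hp.le, sq_nonneg p]

theorem hasDerivAt_critGap_branch (c s : ℝ) {p : ℝ} (hp : 0 < p) (hβ : 0 ≤ branch s p) :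
    HasDerivAt (fun q => critGap c (branch s q) q)
      (1 / (p * (1 + p) * Real.log (1 + p)) *
        ((p / Real.log (1 + p) - 1) + branch s p * p / (1 + p + branch s p * p) *
          (1 - Real.log (1 + p) - branch s p * Real.log (1 + p) / (1 + p + branch s p * p)))) p := by
  have hl := log_one_add_pos hp
  have hB := hasDerivAt_branch s hp
  have hD : 0 < 1 + p + branch s p * p := by positivity
  have h1 := ((hasDerivAt_id p).const_add 1).add (hB.mul (hasDerivAt_id p))
  have h := ((hB.div h1 hD.ne').const_add c).sub
    ((hasDerivAt_const p (1 : ℝ)).div (hasDerivAt_log_one_add hp) hl.ne')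
  refine h.congr_deriv ?_
  simp only [id, Pi.add_apply, Pi.mul_apply]
  generalize branch s p = β at *
  generalize Real.log (1 + p) = l at *
  field_simp
  ring

theorem critGap_branch_deriv_pos {β p : ℝ} (hp : 0 < p) (hβ : 0 ≤ β) :
    0 < 1 / (p * (1 + p) * Real.log (1 + p)) *
        ((p / Real.log (1 + p) - 1) + β * p / (1 + p + β * p) *
          (1 - Real.log (1 + p) - β * Real.log (1 + p) / (1 + p + β * p))) := by
  have hl := log_one_add_pos hp
  have hlp := log_one_add_lt hp
  have hk := log_sq_mul_lt_sq hp
  have hD : 0 < 1 + p + β * p := by positivity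
  generalize Real.log (1 + p) = l at *
  apply mul_pos (by positivity)
  obtain ⟨x, hx⟩ : ∃ x, x = β * p / (1 + p + β * p) := ⟨_, rfl⟩
  have hx0 : 0 ≤ x := by rw [hx]; positivity
  have hx1 : x < 1 := by
    rw [hx, div_lt_one hD]
    linarith
  have hxl : β * l / (1 + p + β * p) = x * (l / p) := by
    rw [hx]
    field_simp
  rw [hxl, ← hx]
  have h0 : 0 < p / l - 1 := by rw [sub_pos, one_lt_div hl]; exact hlp
  have h1 : 0 < p / l - l - l / p := by
    have : p / l - l - l / p = (p ^ 2 - l ^ 2 * (1 + p)) / (l * p) := by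
      field_simp
      ring
    rw [this]
    apply div_pos (by linarith) (by positivity)
  have hlp0 : 0 ≤ x * (1 - x) * (l / p) := by
    have : 0 ≤ 1 - x := by linarith
    positivity
  have : 0 < (1 - x) * (p / l - 1) := mul_pos (by linarith) h0
  nlinarith [mul_nonneg hx0 h1.le]

theorem branch_nonneg {s p : ℝ} (hp : 0 < p) (hps : p ≤ Real.exp s) : 0 ≤ branch s p :=
  div_nonneg (sub_nonneg.2 ((Real.log_le_iff_le_exp hp).2 hps)) (log_one_add_pos hp).le

theorem continuousOn_critGap_branch (c s : ℝ) :
    ContinuousOn (fun q => critGap c (branch s q) q) (Set.Ioc 0 (Real.exp s)) := fun _ hp =>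
  (hasDerivAt_critGap_branch c s hp.1 (branch_nonneg hp.1 hp.2)).continuousAt.continuousWithinAt

theorem critGap_branch_strictMonoOn (c s : ℝ) :
    StrictMonoOn (fun q => critGap c (branch s q) q) (Set.Ioc 0 (Real.exp s)) := by
  refine strictMonoOn_of_deriv_pos (convex_Ioc _ _) (continuousOn_critGap_branch c s)
    fun p hp => ?_
  have hp := interior_subset hp
  have hβ := branch_nonneg hp.1 hp.2
  rw [(hasDerivAt_critGap_branch c s hp.1 hβ).deriv]
  exact critGap_branch_deriv_pos hp.1 hβ

theorem hasDerivAt_lossLog (c s : ℝ) {p : ℝ} (hp : 0 < p) (hβ : 0 ≤ branch s p) :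
    HasDerivAt (lossLog c s) (critGap c (branch s p) p / (1 + p)) p := by
  have hl := log_one_add_pos hp
  have hB := hasDerivAt_branch s hp
  have hD : 0 < 1 + p + branch s p * p := by positivity
  have h1 := ((hasDerivAt_id p).const_add 1).add (hB.mul (hasDerivAt_id p))
  have h := ((hasDerivAt_log_one_add hp).const_mul (c - 1)).add (h1.log hD.ne')
  refine h.congr_deriv ?_
  simp only [id, Pi.add_apply, Pi.mul_apply, critGap]
  generalize branch s p = β at *
  generalize Real.log (1 + p) = l at *
  field_simp
  ring

/-- `lossLog` increases to the right of a point where `critGap` is nonnegative. -/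
theorem lossLog_strictMonoOn {c s p₀ : ℝ} (hp₀ : 0 < p₀) (hp₁ : p₀ ≤ Real.exp s)
    (h : 0 ≤ critGap c (branch s p₀) p₀) :
    StrictMonoOn (lossLog c s) (Set.Icc p₀ (Real.exp s)) := by
  have hd : ∀ p ∈ Set.Icc p₀ (Real.exp s), HasDerivAt (lossLog c s) _ p := fun p hp =>
    hasDerivAt_lossLog c s (hp₀.trans_le hp.1) (branch_nonneg (hp₀.trans_le hp.1) hp.2)
  refine strictMonoOn_of_deriv_pos (convex_Icc _ _)
    (fun p hp => (hd p hp).continuousAt.continuousWithinAt) fun p hp => ?_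
  rw [(hd p (interior_subset hp)).deriv]
  rw [interior_Icc] at hp
  have hp0 : 0 < p := hp₀.trans hp.1
  have := critGap_branch_strictMonoOn c s ⟨hp₀, hp₁⟩ ⟨hp0, hp.2.le⟩ hp.1
  exact div_pos (h.trans_lt this) (by linarith)

/-- `lossLog` decreases to the left of a point where `critGap` is nonpositive. -/
theorem lossLog_strictAntiOn {c s p₀ : ℝ} (hp₀ : 0 < p₀) (hp₁ : p₀ ≤ Real.exp s)
    (h : critGap c (branch s p₀) p₀ ≤ 0) :
    StrictAntiOn (lossLog c s) (Set.Ioc 0 p₀) := by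
  have hd : ∀ p ∈ Set.Ioc 0 p₀, HasDerivAt (lossLog c s) _ p := fun p hp =>
    hasDerivAt_lossLog c s hp.1 (branch_nonneg hp.1 (hp.2.trans hp₁))
  refine strictAntiOn_of_deriv_neg (convex_Ioc _ _)
    (fun p hp => (hd p hp).continuousAt.continuousWithinAt) fun p hp => ?_
  rw [(hd p (interior_subset hp)).deriv]
  rw [interior_Ioc] at hp
  have hp0 : 0 < p := hp.1
  have := critGap_branch_strictMonoOn c s ⟨hp0, hp.2.le.trans hp₁⟩ ⟨hp₀, hp₁⟩ hp.2
  exact div_neg_of_neg_of_pos (this.trans_le h) (by linarith)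

theorem mul_rpow_lt_of_lt {p q β γ : ℝ} (hp : 0 < p) (hpq : p < q) (hβ : 0 ≤ β) (hβγ : β ≤ γ) :
    p * (1 + p) ^ β < q * (1 + q) ^ γ := by
  have h1 : (1 + p) ^ β ≤ (1 + q) ^ β := Real.rpow_le_rpow (by linarith) (by linarith) hβ
  have h2 : (1 + q) ^ β ≤ (1 + q) ^ γ := Real.rpow_le_rpow_of_exponent_le (by linarith) hβγ
  have h3 : 0 < (1 + q) ^ γ := Real.rpow_pos_of_pos (by linarith) _
  calc p * (1 + p) ^ β ≤ p * (1 + q) ^ γ := by gcongr; exact h1.trans h2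
    _ < q * (1 + q) ^ γ := by gcongr

section Solution

variable {η : ℕ} {m : ℝ → ℝ → ℝ}

theorem solution_strictAnti
    (hm : ∀ β σ : ℝ, 0 ≤ β → 0 < σ → 0 < m β σ ∧ m β σ * (1 + m β σ) ^ β = σ)
    {β γ σ : ℝ} (hβ : 0 ≤ β) (hβγ : β < γ) (hσ : 0 < σ) : m γ σ < m β σ := by
  obtain ⟨hp, hpe⟩ := hm β σ hβ hσ
  obtain ⟨hq, hqe⟩ := hm γ σ (hβ.trans hβγ.le) hσ
  by_contra! hle
  rcases hle.lt_or_eq with hlt | heq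
  · have := mul_rpow_lt_of_lt hp hlt hβ hβγ.le
    linarith
  · rw [← heq] at hqe
    have : (1 + m β σ) ^ β < (1 + m β σ) ^ γ :=
      Real.rpow_lt_rpow_of_exponent_lt (by linarith) hβγ
    exact this.ne' (mul_left_cancel₀ hp.ne' (hqe.trans hpe.symm))

theorem solution_strictMono
    (hm : ∀ β σ : ℝ, 0 ≤ β → 0 < σ → 0 < m β σ ∧ m β σ * (1 + m β σ) ^ β = σ)
    {β σ τ : ℝ} (hβ : 0 ≤ β) (hσ : 0 < σ) (hστ : σ < τ) : m β σ < m β τ := by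
  obtain ⟨hp, hpe⟩ := hm β σ hβ hσ
  obtain ⟨hq, hqe⟩ := hm β τ hβ (hσ.trans hστ)
  by_contra! hle
  rcases hle.lt_or_eq with hlt | heq
  · have := mul_rpow_lt_of_lt hq hlt hβ le_rfl
    linarith
  · rw [heq] at hqe
    linarith

theorem branch_solution
    (hm : ∀ β σ : ℝ, 0 ≤ β → 0 < σ → 0 < m β σ ∧ m β σ * (1 + m β σ) ^ β = σ)
    {β σ : ℝ} (hβ : 0 ≤ β) (hσ : 0 < σ) : branch (Real.log σ) (m β σ) = β := by
  obtain ⟨hp, hpe⟩ := hm β σ hβ hσ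
  have hl := log_one_add_pos hp
  have h : Real.log σ = Real.log (m β σ) + β * Real.log (1 + m β σ) := by
    conv_lhs => rw [← hpe]
    rw [Real.log_mul hp.ne' (Real.rpow_pos_of_pos (by linarith) _).ne',
      Real.log_rpow (by linarith)]
  rw [branch, h]
  field_simp
  ring

theorem solution_branch
    (hm : ∀ β σ : ℝ, 0 ≤ β → 0 < σ → 0 < m β σ ∧ m β σ * (1 + m β σ) ^ β = σ)
    {p σ : ℝ} (hσ : 0 < σ) (hp : 0 < p) (hβ : 0 ≤ branch (Real.log σ) p) :
    m (branch (Real.log σ) p) σ = p := by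
  obtain ⟨hq, hqe⟩ := hm _ σ hβ hσ
  have hl := log_one_add_pos hp
  have hpe : p * (1 + p) ^ branch (Real.log σ) p = σ := by
    have : Real.log (1 + p) * branch (Real.log σ) p = Real.log σ - Real.log p := by
      rw [branch]
      field_simp
    rw [Real.rpow_def_of_pos (by linarith), this, Real.exp_sub, Real.exp_log hσ, Real.exp_log hp]
    field_simp
  rcases lt_trichotomy (m (branch (Real.log σ) p) σ) p with h | h | h
  · have := mul_rpow_lt_of_lt hq h hβ le_rfl
    linarith
  · exact h
  · have := mul_rpow_lt_of_lt hp h hβ le_rfl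
    linarith

theorem solution_le
    (hm : ∀ β σ : ℝ, 0 ≤ β → 0 < σ → 0 < m β σ ∧ m β σ * (1 + m β σ) ^ β = σ)
    {β σ : ℝ} (hβ : 0 ≤ β) (hσ : 0 < σ) : m β σ ≤ Real.exp (Real.log σ) := by
  obtain ⟨hp, hpe⟩ := hm β σ hβ hσ
  rw [Real.exp_log hσ]
  have : 1 ≤ (1 + m β σ) ^ β := Real.one_le_rpow (by linarith) hβ
  nlinarith

theorem Ffun_sub_one
    (hm : ∀ β σ : ℝ, 0 ≤ β → 0 < σ → 0 < m β σ ∧ m β σ * (1 + m β σ) ^ β = σ)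
    {β σ : ℝ} (hβ : 0 ≤ β) (hσ : 0 < σ) :
    Ffun η m β σ - 1 = Real.log (1 + m β σ) * critGap (η + 2) β (m β σ) := by
  have hl := log_one_add_pos (hm β σ hβ hσ).1
  rw [Ffun, critGap, mul_sub, mul_one_div_cancel hl.ne', mul_comm]

theorem critGap_eq_zero_iff
    (hm : ∀ β σ : ℝ, 0 ≤ β → 0 < σ → 0 < m β σ ∧ m β σ * (1 + m β σ) ^ β = σ)
    {β σ : ℝ} (hβ : 0 ≤ β) (hσ : 0 < σ) :
    critGap (η + 2) β (m β σ) = 0 ↔ Ffun η m β σ = 1 := by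
  have hl := log_one_add_pos (hm β σ hβ hσ).1
  rw [← sub_eq_zero (a := Ffun η m β σ), Ffun_sub_one hm hβ hσ, mul_eq_zero]
  simp [hl.ne']

theorem critGap_solution_anti
    (hm : ∀ β σ : ℝ, 0 ≤ β → 0 < σ → 0 < m β σ ∧ m β σ * (1 + m β σ) ^ β = σ)
    (c : ℝ) {β γ σ : ℝ} (hβ : 0 ≤ β) (hβγ : β < γ) (hσ : 0 < σ) :
    critGap c γ (m γ σ) < critGap c β (m β σ) := by
  have hγ := hβ.trans hβγ.le
  have h := critGap_branch_strictMonoOn c (Real.log σ)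
    ⟨(hm γ σ hγ hσ).1, solution_le hm hγ hσ⟩ ⟨(hm β σ hβ hσ).1, solution_le hm hβ hσ⟩
    (solution_strictAnti hm hβ hβγ hσ)
  simpa only [branch_solution hm hβ hσ, branch_solution hm hγ hσ] using h

theorem critGap_solution_mono
    (hm : ∀ β σ : ℝ, 0 ≤ β → 0 < σ → 0 < m β σ ∧ m β σ * (1 + m β σ) ^ β = σ)
    (c : ℝ) {β σ τ : ℝ} (hβ : 0 ≤ β) (hσ : 0 < σ) (hστ : σ < τ) :
    critGap c β (m β σ) < critGap c β (m β τ) :=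
  critGap_strictMonoOn c hβ (hm β σ hβ hσ).1 (hm β τ hβ (hσ.trans hστ)).1
    (solution_strictMono hm hβ hσ hστ)

theorem exists_critGap_eq_zero
    (hm : ∀ β σ : ℝ, 0 ≤ β → 0 < σ → 0 < m β σ ∧ m β σ * (1 + m β σ) ^ β = σ)
    {c β γ σ : ℝ} (hβ : 0 ≤ β) (hβγ : β < γ) (hσ : 0 < σ)
    (h₀ : 0 < critGap c β (m β σ)) (h₁ : critGap c γ (m γ σ) < 0) :
    ∃ b ∈ Set.Ioo β γ, critGap c b (m b σ) = 0 := by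
  have hγ := hβ.trans hβγ.le
  have hlt := solution_strictAnti hm hβ hβγ hσ
  have hq := (hm γ σ hγ hσ).1
  have hle := solution_le hm hβ hσ
  have hivt := intermediate_value_Ioo hlt.le
    ((continuousOn_critGap_branch c (Real.log σ)).mono fun p hp =>
      ⟨hq.trans_le hp.1, hp.2.trans hle⟩)
  simp only [branch_solution hm hβ hσ, branch_solution hm hγ hσ] at hivt
  obtain ⟨p, hp, hp0⟩ := hivt ⟨h₁, h₀⟩
  have hpos := hq.trans hp.1
  have hb := branch_nonneg hpos (hp.2.le.trans hle)
  have hmb := solution_branch hm hσ hpos hb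
  refine ⟨branch (Real.log σ) p, ⟨?_, ?_⟩, by rw [hmb]; exact hp0⟩
  · by_contra! h
    rcases h.lt_or_eq with h | h
    · have := solution_strictAnti hm hb h hσ
      rw [hmb] at this
      exact lt_asymm this hp.2
    · rw [h] at hmb
      exact hp.2.ne' hmb
  · by_contra! h
    rcases h.lt_or_eq with h | h
    · have := solution_strictAnti hm hγ h hσ
      rw [hmb] at this
      exact lt_asymm this hp.1
    · rw [← h] at hmb
      exact hp.1.ne hmb

theorem thetaB_eq
    (hm : ∀ β σ : ℝ, 0 ≤ β → 0 < σ → 0 < m β σ ∧ m β σ * (1 + m β σ) ^ β = σ)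
    {β σ : ℝ} (hβ : 0 ≤ β) (hσ : 0 < σ) (hmem : β ∈ Set.Icc ((η : ℝ) - 1) (η + 1)) :
    thetaB η m σ β = σ * Real.exp (-lossLog (η + 2) (Real.log σ) (m β σ)) := by
  have hp := (hm β σ hβ hσ).1
  have hD : 0 < 1 + m β σ + β * m β σ := by positivity
  have hf : β - fR η β = -((η : ℝ) + 2 - 1) := by
    unfold fR
    split_ifs with h1 h2
    · linarith [le_antisymm h1 hmem.1]
    · ring
    · exact absurd hmem.2 h2
  rw [thetaB, hf, lossLog, branch_solution hm hβ hσ, neg_add, Real.exp_add,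
    Real.exp_neg (Real.log _), Real.exp_log hD, Real.rpow_def_of_pos (by linarith)]
  rw [show (β + 1) * (1 + m β σ) - β = 1 + m β σ + β * m β σ by ring,
    show Real.log (1 + m β σ) * -((η : ℝ) + 2 - 1) = -(((η : ℝ) + 2 - 1) * Real.log (1 + m β σ)) by
      ring, div_eq_mul_inv, mul_assoc]

theorem thetaB_strictMonoOn (hη : 1 ≤ η)
    (hm : ∀ β σ : ℝ, 0 ≤ β → 0 < σ → 0 < m β σ ∧ m β σ * (1 + m β σ) ^ β = σ)
    {b σ : ℝ} (hσ : 0 < σ) (hb : b ∈ Set.Icc ((η : ℝ) - 1) (η + 1))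
    (h : 0 ≤ critGap (η + 2) b (m b σ)) :
    StrictMonoOn (thetaB η m σ) (Set.Icc ((η : ℝ) - 1) b) := by
  have hη' : (0 : ℝ) ≤ (η : ℝ) - 1 := sub_nonneg.2 (by exact_mod_cast hη)
  have hb0 := hη'.trans hb.1
  have hmono := lossLog_strictMonoOn (c := η + 2) (hm b σ hb0 hσ).1 (solution_le hm hb0 hσ)
    (by rwa [branch_solution hm hb0 hσ])
  have hmem : ∀ x ∈ Set.Icc ((η : ℝ) - 1) b,
      m x σ ∈ Set.Icc (m b σ) (Real.exp (Real.log σ)) := fun x hx => by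
    refine ⟨?_, solution_le hm (hη'.trans hx.1) hσ⟩
    rcases hx.2.lt_or_eq with hlt | rfl
    · exact (solution_strictAnti hm (hη'.trans hx.1) hlt hσ).le
    · exact le_rfl
  intro x hx y hy hxy
  rw [thetaB_eq hm (hη'.trans hx.1) hσ ⟨hx.1, hx.2.trans hb.2⟩,
    thetaB_eq hm (hη'.trans hy.1) hσ ⟨hy.1, hy.2.trans hb.2⟩]
  have := hmono (hmem y hy) (hmem x hx) (solution_strictAnti hm (hη'.trans hx.1) hxy hσ)
  gcongr

theorem thetaB_strictAntiOn (hη : 1 ≤ η)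
    (hm : ∀ β σ : ℝ, 0 ≤ β → 0 < σ → 0 < m β σ ∧ m β σ * (1 + m β σ) ^ β = σ)
    {b σ : ℝ} (hσ : 0 < σ) (hb : b ∈ Set.Icc ((η : ℝ) - 1) (η + 1))
    (h : critGap (η + 2) b (m b σ) ≤ 0) :
    StrictAntiOn (thetaB η m σ) (Set.Icc b (η + 1)) := by
  have hη' : (0 : ℝ) ≤ (η : ℝ) - 1 := sub_nonneg.2 (by exact_mod_cast hη)
  have hb0 := hη'.trans hb.1
  have hanti := lossLog_strictAntiOn (c := η + 2) (hm b σ hb0 hσ).1 (solution_le hm hb0 hσ)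
    (by rwa [branch_solution hm hb0 hσ])
  have hmem : ∀ x ∈ Set.Icc b ((η : ℝ) + 1), m x σ ∈ Set.Ioc 0 (m b σ) := fun x hx => by
    refine ⟨(hm x σ (hb0.trans hx.1) hσ).1, ?_⟩
    rcases hx.1.lt_or_eq with hlt | rfl
    · exact (solution_strictAnti hm hb0 hlt hσ).le
    · exact le_rfl
  intro x hx y hy hxy
  rw [thetaB_eq hm (hb0.trans hx.1) hσ ⟨hb.1.trans hx.1, hx.2⟩,
    thetaB_eq hm (hb0.trans hy.1) hσ ⟨hb.1.trans hy.1, hy.2⟩]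
  have := hanti (hmem y hy) (hmem x hx) (solution_strictAnti hm (hb0.trans hx.1) hxy hσ)
  gcongr

end Solution

/-- The threshold theorem. With `σ_min = σ(η−1)` and `σ_max = σ(η+1)` (the unique
solutions of `F(η∓1, ·) = 1`): `0 < σ_min < σ_max`; for `0 < σ ≤ σ_min` the throughput is
strictly decreasing on `[η−1,η+1]` with unique maximizer `η−1`; for `σ ≥ σ_max` it is
strictly increasing with unique maximizer `η+1`; for `σ_min < σ < σ_max` there is a unique
`β(σ) ∈ (η−1,η+1)` with `F(β(σ),σ) = 1`, the throughput attains its maximum on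
`[η−1,η+1]` there, it strictly increases at `β = η−1` and strictly decreases at
`β = η+1`, and `σ ↦ β(σ)` is strictly increasing on `(σ_min, σ_max)`. -/
theorem threshold_theorem (η : ℕ) (hη : 2 ≤ η) (m : ℝ → ℝ → ℝ)
    (hm : ∀ β σ : ℝ, 0 ≤ β → 0 < σ →
      0 < m β σ ∧ m β σ * (1 + m β σ) ^ β = σ)
    (σmin σmax : ℝ)
    (hmin : 0 < σmin ∧ Ffun η m ((η : ℝ) - 1) σmin = 1)
    (hmax : 0 < σmax ∧ Ffun η m ((η : ℝ) + 1) σmax = 1) :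
    σmin < σmax ∧
    (∀ σ : ℝ, 0 < σ → σ ≤ σmin →
      StrictAntiOn (thetaB η m σ) (Set.Icc ((η : ℝ) - 1) ((η : ℝ) + 1)) ∧
      ∀ β ∈ Set.Icc ((η : ℝ) - 1) ((η : ℝ) + 1), β ≠ (η : ℝ) - 1 →
        thetaB η m σ β < thetaB η m σ ((η : ℝ) - 1)) ∧
    (∀ σ : ℝ, σmax ≤ σ →
      StrictMonoOn (thetaB η m σ) (Set.Icc ((η : ℝ) - 1) ((η : ℝ) + 1)) ∧
      ∀ β ∈ Set.Icc ((η : ℝ) - 1) ((η : ℝ) + 1), β ≠ (η : ℝ) + 1 →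
        thetaB η m σ β < thetaB η m σ ((η : ℝ) + 1)) ∧
    (∀ σ : ℝ, σmin < σ → σ < σmax →
      ∃! b : ℝ, b ∈ Set.Ioo ((η : ℝ) - 1) ((η : ℝ) + 1) ∧ Ffun η m b σ = 1) ∧
    (∀ σ : ℝ, σmin < σ → σ < σmax →
      ∀ b ∈ Set.Ioo ((η : ℝ) - 1) ((η : ℝ) + 1), Ffun η m b σ = 1 →
        (∀ β ∈ Set.Icc ((η : ℝ) - 1) ((η : ℝ) + 1),
          thetaB η m σ β ≤ thetaB η m σ b) ∧
        (∃ ε > 0, StrictMonoOn (thetaB η m σ)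
          (Set.Icc ((η : ℝ) - 1) ((η : ℝ) - 1 + ε))) ∧
        (∃ ε > 0, StrictAntiOn (thetaB η m σ)
          (Set.Icc ((η : ℝ) + 1 - ε) ((η : ℝ) + 1)))) ∧
    (∀ b : ℝ → ℝ,
      (∀ σ ∈ Set.Ioo σmin σmax,
        b σ ∈ Set.Ioo ((η : ℝ) - 1) ((η : ℝ) + 1) ∧ Ffun η m (b σ) σ = 1) →
      StrictMonoOn b (Set.Ioo σmin σmax)) := by
  have hη1 : 1 ≤ η := by omega
  have hlo : (0 : ℝ) ≤ (η : ℝ) - 1 := sub_nonneg.2 (by exact_mod_cast hη1)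
  have hhi : (0 : ℝ) ≤ (η : ℝ) + 1 := by positivity
  have hlt : (η : ℝ) - 1 < (η : ℝ) + 1 := by linarith
  obtain ⟨hσmin, hFmin⟩ := hmin
  obtain ⟨hσmax, hFmax⟩ := hmax
  rw [← critGap_eq_zero_iff hm hlo hσmin] at hFmin
  rw [← critGap_eq_zero_iff hm hhi hσmax] at hFmax
  have hlo_pos : ∀ σ, σmin < σ → 0 < critGap (η + 2) ((η : ℝ) - 1) (m ((η : ℝ) - 1) σ) :=
    fun σ h => hFmin ▸ critGap_solution_mono hm _ hlo hσmin h
  have hhi_neg : ∀ σ, 0 < σ → σ < σmax →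
      critGap (η + 2) ((η : ℝ) + 1) (m ((η : ℝ) + 1) σ) < 0 :=
    fun σ h0 h => (critGap_solution_mono hm _ hhi h0 h).trans_eq hFmax
  refine ⟨?_, ?_, ?_, ?_, ?_, ?_⟩
  · by_contra! h
    have h1 := critGap_solution_anti hm (η + 2) hlo hlt hσmax
    rcases h.lt_or_eq with h | h
    · have h2 := critGap_solution_mono hm (η + 2) hlo hσmax h
      linarith
    · rw [h, hFmin, ← h, hFmax] at h1
      exact lt_irrefl _ h1
  · intro σ hσ hle
    have hK : critGap (η + 2) ((η : ℝ) - 1) (m ((η : ℝ) - 1) σ) ≤ 0 := by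
      rcases hle.lt_or_eq with h | rfl
      · exact ((critGap_solution_mono hm _ hlo hσ h).trans_eq hFmin).le
      · exact hFmin.le
    have hanti := thetaB_strictAntiOn hη1 hm hσ ⟨le_rfl, hlt.le⟩ hK
    exact ⟨hanti, fun β hβ hne => hanti ⟨le_rfl, hlt.le⟩ hβ (lt_of_le_of_ne hβ.1 hne.symm)⟩
  · intro σ hle
    have hσ := hσmax.trans_le hle
    have hK : 0 ≤ critGap (η + 2) ((η : ℝ) + 1) (m ((η : ℝ) + 1) σ) := by
      rcases hle.lt_or_eq with h | rfl
      · exact (hFmax.symm.trans_lt (critGap_solution_mono hm _ hhi hσmax h)).le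
      · exact hFmax.ge
    have hmono := thetaB_strictMonoOn hη1 hm hσ ⟨hlt.le, le_rfl⟩ hK
    exact ⟨hmono, fun β hβ hne => hmono hβ ⟨hlt.le, le_rfl⟩ (lt_of_le_of_ne hβ.2 hne)⟩
  · intro σ h1 h2
    have hσ := hσmin.trans h1
    obtain ⟨b, hb, hb0⟩ := exists_critGap_eq_zero hm hlo hlt hσ (hlo_pos σ h1) (hhi_neg σ hσ h2)
    have hbn := hlo.trans hb.1.le
    refine ⟨b, ⟨hb, (critGap_eq_zero_iff hm hbn hσ).1 hb0⟩, ?_⟩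
    rintro y ⟨hy, hFy⟩
    have hyn := hlo.trans hy.1.le
    rw [← critGap_eq_zero_iff hm hyn hσ] at hFy
    rcases lt_trichotomy y b with h | h | h
    · linarith [critGap_solution_anti hm (η + 2) hyn h hσ]
    · exact h
    · linarith [critGap_solution_anti hm (η + 2) hbn h hσ]
  · intro σ h1 h2 b hb hFb
    have hσ := hσmin.trans h1
    have hbI := Set.Ioo_subset_Icc_self hb
    rw [← critGap_eq_zero_iff hm (hlo.trans hb.1.le) hσ] at hFb
    have hmono := thetaB_strictMonoOn hη1 hm hσ hbI hFb.ge
    have hanti := thetaB_strictAntiOn hη1 hm hσ hbI hFb.le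
    refine ⟨fun β hβ => ?_, ⟨b - (η - 1), sub_pos.2 hb.1, ?_⟩, ⟨η + 1 - b, sub_pos.2 hb.2, ?_⟩⟩
    · rcases le_total β b with h | h
      · exact hmono.monotoneOn ⟨hβ.1, h⟩ ⟨hb.1.le, le_rfl⟩ h
      · exact hanti.antitoneOn ⟨le_rfl, hb.2.le⟩ ⟨h, hβ.2⟩ h
    · rwa [add_sub_cancel]
    · rwa [sub_sub_cancel]
  · intro b hb σ hσ τ hτ hστ
    obtain ⟨hbσ, hFσ⟩ := hb σ hσ
    obtain ⟨hbτ, hFτ⟩ := hb τ hτ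
    have hσ0 := hσmin.trans hσ.1
    have hτ0 := hσmin.trans hτ.1
    have hn := hlo.trans hbσ.1.le
    have hn' := hlo.trans hbτ.1.le
    rw [← critGap_eq_zero_iff hm hn hσ0] at hFσ
    rw [← critGap_eq_zero_iff hm hn' hτ0] at hFτ
    have hlt' := critGap_solution_mono hm (η + 2) hn hσ0 hστ
    by_contra! h
    rcases h.lt_or_eq with h | h
    · linarith [critGap_solution_anti hm (η + 2) hn' h hτ0]
    · rw [h] at hFτ
      linarith
end

section
/- Let η ≥ 0 be a real number, τ = (√5 − 1)/2, and κ = τ/(η+1). Then (η + 2 + (η−1)/(1+ηκ))·ln(1+κ) < 1 < (η + 2 + (η+1)/(1+(η+2)κ))·ln(1+κ). -/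
/-- For `η ≥ 0`, `τ = (√5 − 1)/2` and `κ = τ/(η+1)`:
`(η + 2 + (η−1)/(1+ηκ))·ln(1+κ) < 1 < (η + 2 + (η+1)/(1+(η+2)κ))·ln(1+κ)`. -/
theorem threshold_inequalities (η : ℝ) (hη : 0 ≤ η) (τ κ : ℝ)
    (hτ : τ = (Real.sqrt 5 - 1) / 2) (hκ : κ = τ / (η + 1)) :
    (η + 2 + (η - 1) / (1 + η * κ)) * Real.log (1 + κ) < 1 ∧
    1 < (η + 2 + (η + 1) / (1 + (η + 2) * κ)) * Real.log (1 + κ) := by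
  have h5 : Real.sqrt 5 ^ 2 = 5 := Real.sq_sqrt (by norm_num)
  have hsqrt : 2 < Real.sqrt 5 := Real.lt_sqrt_of_sq_lt (by norm_num)
  have hτ_sq : τ ^ 2 + τ = 1 := by rw [hτ]; linarith
  have hτ_half : 1 / 2 < τ := by linarith
  have hκ_pos : 0 < κ := by rw [hκ]; apply div_pos <;> linarith
  have hτκ : τ = (η + 1) * κ := by rw [hκ]; field_simp
  have hηκ : 0 ≤ η * κ := by positivity
  have hκτ : κ ≤ τ := by linarith
  constructor
  · have hκA : (η + 2 + (η - 1) / (1 + η * κ)) * κ = 1 - κ ^ 2 / (1 + η * κ) := by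
      rw [hτκ] at hτ_sq
      field_simp
      linear_combination hτ_sq
    have hlog : Real.log (1 + κ) < κ := by
      have := Real.log_lt_sub_one_of_pos (x := 1 + κ) (by linarith) (by linarith)
      linarith
    have hA : 0 < η + 2 + (η - 1) / (1 + η * κ) := by
      refine pos_of_mul_pos_left (b := κ) ?_ hκ_pos.le
      rw [hκA, sub_pos, div_lt_one (by positivity)]
      nlinarith
    calc _ < (η + 2 + (η - 1) / (1 + η * κ)) * κ := mul_lt_mul_of_pos_left hlog hA
      _ ≤ 1 := by
        rw [hκA]
        have : 0 ≤ κ ^ 2 / (1 + η * κ) := by positivity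
        linarith
  · have hκB : (η + 2 + (η + 1) / (1 + (η + 2) * κ)) * κ
        = 1 + (2 * τ * κ + κ ^ 2) / (1 + τ + κ) := by
      rw [hτκ] at hτ_sq ⊢
      rw [show 1 + (η + 1) * κ + κ = 1 + (η + 2) * κ by ring]
      field_simp
      linear_combination hτ_sq
    have hhalf : κ / 2 < (2 * τ * κ + κ ^ 2) / (1 + τ + κ) := by
      rw [lt_div_iff₀ (by linarith)]
      nlinarith
    calc (1 : ℝ) < (1 + (2 * τ * κ + κ ^ 2) / (1 + τ + κ)) * (2 / (κ + 2)) := by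
          rw [← mul_div_assoc, one_lt_div (by linarith)]
          linarith
      _ = (η + 2 + (η + 1) / (1 + (η + 2) * κ)) * (2 * κ / (κ + 2)) := by
          rw [← hκB]; ring
      _ ≤ _ := mul_le_mul_of_nonneg_left (Real.le_log_one_add_of_nonneg hκ_pos.le)
          (by positivity)
end

section
/- Fix an integer η ≥ 2 and let τ = (√5 − 1)/2, κ = τ/(η+1), σ_min = σ(η−1), σ_max = σ(η+1). Then κ·(1+κ)^{η−1} < σ_min and σ_max < κ·(1+κ)^{η+1}; in particular [σ_min, σ_max] ⊆ [κ(1+κ)^{η−1}, κ(1+κ)^{η+1}]. -/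
/-- `(c + β / (1 + μ + βμ)) log (1 + μ)` is monotone in `μ > 0` when `0 ≤ β ≤ c`. -/
theorem log_mul_add_div_le {c β a b : ℝ} (hβ : 0 ≤ β) (hc : β ≤ c) (ha : 0 < a) (hab : a ≤ b) :
    (c + β / (1 + a + β * a)) * Real.log (1 + a) ≤
      (c + β / (1 + b + β * b)) * Real.log (1 + b) := by
  have hb : 0 < b := ha.trans_le hab
  have hβa : 0 ≤ β * a := by positivity
  have hβb : 0 ≤ β * b := by positivity
  have hA : 0 < 1 + a + β * a := by positivity
  have hB : 0 < 1 + b + β * b := by positivity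
  have hlog : (b - a) / (1 + b) ≤ Real.log (1 + b) - Real.log (1 + a) := by
    have h := Real.one_sub_inv_le_log_of_pos (x := (1 + b) / (1 + a)) (by positivity)
    rw [Real.log_div (by positivity) (by positivity)] at h
    calc (b - a) / (1 + b) = 1 - ((1 + b) / (1 + a))⁻¹ := by field_simp; ring
      _ ≤ _ := h
  have hloga : Real.log (1 + a) ≤ a := by
    linarith [Real.log_le_sub_one_of_pos (show 0 < 1 + a by positivity)]
  have hdiff : β / (1 + a + β * a) - β / (1 + b + β * b) =
      β * (1 + β) * (b - a) / ((1 + a + β * a) * (1 + b + β * b)) := by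
    field_simp; ring
  have hdiff_nonneg : 0 ≤ β / (1 + a + β * a) - β / (1 + b + β * b) := by
    rw [hdiff]
    have := sub_nonneg.2 hab
    positivity
  have hfst : c * ((b - a) / (1 + b)) ≤
      (c + β / (1 + b + β * b)) * (Real.log (1 + b) - Real.log (1 + a)) := by
    have := sub_nonneg.2 hab
    refine mul_le_mul ?_ hlog (by positivity) ?_
    · have : 0 ≤ β / (1 + b + β * b) := by positivity
      linarith
    · have : 0 ≤ c := hβ.trans hc
      positivity
  have hsnd : (β / (1 + a + β * a) - β / (1 + b + β * b)) * Real.log (1 + a) ≤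
      c * ((b - a) / (1 + b)) := by
    calc _ ≤ (β / (1 + a + β * a) - β / (1 + b + β * b)) * a := by gcongr
      _ = (a + β * a) / (1 + a + β * a) * (β * ((b - a) / (1 + b + β * b))) := by
        rw [hdiff]; field_simp
      _ ≤ 1 * (c * ((b - a) / (1 + b))) := by
        have := sub_nonneg.2 hab
        have h1 : (a + β * a) / (1 + a + β * a) ≤ 1 := by
          rw [div_le_one hA]; linarith
        have h2 : (b - a) / (1 + b + β * b) ≤ (b - a) / (1 + b) := by
          exact div_le_div_of_nonneg_left this (by positivity) (by linarith)
        have h3 : 0 ≤ c := hβ.trans hc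
        gcongr
      _ = _ := one_mul _
  linarith

/-- For `t` the positive root of `t² + t = 1`, the function `F(n - 2, ·)` lies below `1` at
`μ₀ = t / n`. -/
theorem log_mul_add_div_lt_one {t n : ℝ} (ht : 0 < t) (ht2 : t ^ 2 = 1 - t) (hn : 2 ≤ n) :
    (n + 1 + (n - 2) / (1 + t / n + (n - 2) * (t / n))) * Real.log (1 + t / n) < 1 := by
  have hn0 : 0 < n := by linarith
  have ht1 : t < 1 := by nlinarith
  have ht3 : t ^ 3 = 2 * t - 1 := by linear_combination (t - 1) * ht2
  have hD : 0 < n - t ^ 2 := by nlinarith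
  have hκ : 0 < t / n := by positivity
  have hlog : Real.log (1 + t / n) < t / n := by
    linarith [Real.log_lt_sub_one_of_pos (show 0 < 1 + t / n by positivity) (by linarith)]
  have hden : 1 + t / n + (n - 2) * (t / n) = (n - t ^ 2) / (n * t) := by
    field_simp
    linear_combination (n + t - 1) * ht2 - ht3
  have hle : (n - 2) / (1 + t / n + (n - 2) * (t / n)) ≤ n * t - 1 := by
    rw [hden, div_div_eq_mul_div, div_le_iff₀ hD]
    nlinarith
  have hpos : 0 ≤ (n - 2) / (1 + t / n + (n - 2) * (t / n)) := by
    rw [hden]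
    have := sub_nonneg.2 hn
    positivity
  calc _ < (n + 1 + (n - 2) / (1 + t / n + (n - 2) * (t / n))) * (t / n) := by gcongr
    _ ≤ (n + 1 + (n * t - 1)) * (t / n) := by gcongr
    _ = 1 := by field_simp; linear_combination n * ht2

/-- For `t` the positive root of `t² + t = 1`, the function `F(n, ·)` lies above `1` at
`μ₀ = t / n`. -/
theorem one_lt_log_mul_add_div {t n : ℝ} (ht : 0 < t) (ht2 : t ^ 2 = 1 - t) (hn : 0 < n) :
    1 < (n + 1 + n / (1 + t / n + n * (t / n))) * Real.log (1 + t / n) := by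
  have ht3 : t ^ 3 = 2 * t - 1 := by linear_combination (t - 1) * ht2
  have htlt : t < 3 / 4 := by nlinarith
  have hκ : 0 < t / n := by positivity
  have hlog := Real.le_log_one_add_of_nonneg hκ.le
  have hden : 1 + t / n + n * (t / n) = (n + t ^ 2) / (n * t) := by
    field_simp
    linear_combination (n + t - 1) * ht2 - ht3
  have hle : n * t - t ^ 3 ≤ n / (1 + t / n + n * (t / n)) := by
    rw [hden, div_div_eq_mul_div, le_div_iff₀ (by positivity)]
    have : 0 ≤ t ^ 5 := by positivity
    linarith
  calc 1 < (n + 1 + (n * t - t ^ 3)) * (2 * (t / n) / (t / n + 2)) := by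
        have : 2 * (t / n) / (t / n + 2) = 2 * t / (t + 2 * n) := by
          field_simp
        rw [this, ← mul_div_assoc, lt_div_iff₀ (by positivity), ht3]
        nlinarith
    _ ≤ (n + 1 + n / (1 + t / n + n * (t / n))) * (2 * (t / n) / (t / n + 2)) := by gcongr
    _ ≤ _ := by gcongr

/-- With `τ = (√5−1)/2`, `κ = τ/(η+1)`, `σ_min = σ(η−1)` and `σ_max = σ(η+1)` (where
`σ(β)` is the unique `σ > 0` with `F(β,σ) = 1`):
`κ(1+κ)^{η−1} < σ_min` and `σ_max < κ(1+κ)^{η+1}`, so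
`[σ_min, σ_max] ⊆ [κ(1+κ)^{η−1}, κ(1+κ)^{η+1}]`. -/
theorem threshold_interval_bounds (η : ℕ) (hη : 2 ≤ η) (m : ℝ → ℝ → ℝ)
    (hm : ∀ β σ : ℝ, 0 ≤ β → 0 < σ →
      0 < m β σ ∧ m β σ * (1 + m β σ) ^ β = σ)
    (s : ℝ → ℝ) (hs : ∀ β : ℝ, 0 < β → 0 < s β ∧ Ffun η m β (s β) = 1)
    (τ κ : ℝ) (hτ : τ = (Real.sqrt 5 - 1) / 2) (hκ : κ = τ / ((η : ℝ) + 1)) :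
    κ * (1 + κ) ^ ((η : ℝ) - 1) < s ((η : ℝ) - 1) ∧
    s ((η : ℝ) + 1) < κ * (1 + κ) ^ ((η : ℝ) + 1) := by
  have h5 : Real.sqrt 5 ^ 2 = 5 := Real.sq_sqrt (by norm_num)
  have hτ0 : 0 < τ := by
    have : 1 < Real.sqrt 5 := Real.lt_sqrt_of_sq_lt (by norm_num)
    rw [hτ]; linarith
  have hτ2 : τ ^ 2 = 1 - τ := by rw [hτ]; linear_combination h5 / 4
  have hη' : (2 : ℝ) ≤ η := by exact_mod_cast hη
  have hκ0 : 0 < κ := by rw [hκ]; positivity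
  constructor
  · obtain ⟨hs0, hF⟩ := hs ((η : ℝ) - 1) (by linarith)
    obtain ⟨hm0, hmeq⟩ := hm ((η : ℝ) - 1) (s ((η : ℝ) - 1)) (by linarith) hs0
    unfold Ffun at hF
    have hlt : κ < m ((η : ℝ) - 1) (s ((η : ℝ) - 1)) := by
      by_contra! h
      have h1 := log_mul_add_div_le (c := (η : ℝ) + 2) (β := (η : ℝ) - 1)
        (by linarith) (by linarith) hm0 h
      have h2 := log_mul_add_div_lt_one hτ0 hτ2 (n := (η : ℝ) + 1) (by linarith)
      rw [← hκ, show (η : ℝ) + 1 + 1 = η + 2 by ring,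
        show (η : ℝ) + 1 - 2 = η - 1 by ring] at h2
      linarith
    rw [← hmeq]
    have : (0 : ℝ) < (η : ℝ) - 1 := by linarith
    gcongr
  · obtain ⟨hs0, hF⟩ := hs ((η : ℝ) + 1) (by linarith)
    obtain ⟨hm0, hmeq⟩ := hm ((η : ℝ) + 1) (s ((η : ℝ) + 1)) (by linarith) hs0
    unfold Ffun at hF
    have hlt : m ((η : ℝ) + 1) (s ((η : ℝ) + 1)) < κ := by
      by_contra! h
      have h1 := log_mul_add_div_le (c := (η : ℝ) + 2) (β := (η : ℝ) + 1)
        (by linarith) (by linarith) hκ0 h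
      have h2 := one_lt_log_mul_add_div hτ0 hτ2 (n := (η : ℝ) + 1) (by linarith)
      rw [← hκ, show (η : ℝ) + 1 + 1 = η + 2 by ring] at h2
      linarith
    conv_lhs => rw [← hmeq]
    gcongr
end

section
/- Let τ = (√5 − 1)/2 and, for each integer η ≥ 2, let σ_min(η) = σ(η−1) and σ_max(η) = σ(η+1). Then (η+1)² · (σ_max(η) − σ_min(η)) → 2e^τ/(7 + 4τ) as η → ∞; i.e. σ_max − σ_min ∼ (2e^τ/(7+4τ))·(η+1)^{−2}. -/
open Filter Topology

/-- Clearing denominators in the threshold equation at scale `h = 1 / N`, with `x = N μ` and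
`N log (1 + μ) = x - h q`, turns it into a perturbation of `x² + x - 1 = 0`. -/
lemma threshold_quadratic {N b x q : ℝ} (hN : 0 < N) (hx : 0 < x) (hb : 0 < N + b)
    (h : (N + 1 + (N + b) / (1 + x / N + (N + b) * (x / N))) * ((x - N⁻¹ * q) / N) = 1) :
    x ^ 2 + x - 1 = N⁻¹ * ((1 + b) * x + (2 + x) * q -
      (x - N⁻¹ * q) * (1 + x + (1 + b) * x + b + N⁻¹ * ((1 + b) * x))) := by
  have hD : 0 < N + x + (N + b) * x := by positivity
  have h2 : (N + b) / (1 + x / N + (N + b) * (x / N)) = N * (N + b) / (N + x + (N + b) * x) := by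
    have : 1 + x / N + (N + b) * (x / N) = (N + x + (N + b) * x) / N := by field_simp
    rw [this]
    field_simp
  rw [h2] at h
  field_simp at h ⊢
  linear_combination h

/-- Crude bounds on the rescaled solution `N μ` of the threshold equation. -/
lemma threshold_bounds {N μ A : ℝ} (hN : 2 ≤ N) (hμ : 0 < μ) (hA : 0 ≤ A)
    (h : (N + 1 + A) * Real.log (1 + μ) = 1) :
    N * μ ≤ 2 ∧ 0 ≤ N * (N * μ - N * Real.log (1 + μ)) ∧
      N * (N * μ - N * Real.log (1 + μ)) ≤ 4 := by
  have h1 : Real.log (1 + μ) ≤ μ := by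
    have := Real.log_le_sub_one_of_pos (show 0 < 1 + μ by linarith)
    linarith
  have h0 : 0 < Real.log (1 + μ) := Real.log_pos (by linarith)
  have h2 : μ / (1 + μ) ≤ Real.log (1 + μ) := by
    have := Real.one_sub_inv_le_log_of_pos (show 0 < 1 + μ by linarith)
    have e : μ / (1 + μ) = 1 - (1 + μ)⁻¹ := by field_simp; ring
    linarith
  have h3 : N * Real.log (1 + μ) ≤ 1 := by nlinarith
  have h4 : μ ≤ Real.log (1 + μ) * (1 + μ) := by
    rwa [div_le_iff₀ (by linarith)] at h2
  have h5 : N * μ ≤ 1 + μ := by nlinarith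
  have h6 : N * μ ≤ 2 := by nlinarith
  refine ⟨h6, mul_nonneg (by linarith) (by nlinarith), ?_⟩
  have h7 : μ - Real.log (1 + μ) ≤ μ ^ 2 := by nlinarith
  have h8 : N * (N * μ - N * Real.log (1 + μ)) ≤ (N * μ) ^ 2 := by
    have := mul_le_mul_of_nonneg_left h7 (sq_nonneg N)
    nlinarith
  have h9 : 0 ≤ N * μ := by positivity
  nlinarith

lemma abs_log_one_add_sub_quadratic_le {u : ℝ} (h0 : 0 ≤ u) (h1 : u ≤ 1 / 2) :
    |u - Real.log (1 + u) - u ^ 2 / 2| ≤ 2 * u ^ 3 := by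
  have h := Real.abs_log_sub_add_sum_range_le (x := -u) (by rw [abs_neg, abs_of_nonneg h0]; linarith) 2
  have e : |u - Real.log (1 + u) - u ^ 2 / 2|
      = |(∑ i ∈ Finset.range 2, (-u) ^ (i + 1) / ((i : ℝ) + 1)) + Real.log (1 - -u)| := by
    rw [← abs_neg]
    congr 1
    simp [Finset.sum_range_succ]
    ring
  rw [e]
  refine h.trans ?_
  rw [abs_neg, abs_of_nonneg h0, div_le_iff₀ (by linarith)]
  have h2 : 0 ≤ u ^ 3 * (1 / 2 - u) := mul_nonneg (pow_nonneg h0 3) (sub_nonneg.2 h1)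
  norm_num
  linarith

/-- If `x → t` and `N → ∞` then `N (x - N log (1 + x / N)) → t² / 2`. -/
lemma tendsto_mul_sub_mul_log {ι : Type*} {l : Filter ι} {N x : ι → ℝ} {t : ℝ}
    (hN : Tendsto N l atTop) (hx : Tendsto x l (𝓝 t)) (hx0 : ∀ᶠ i in l, 0 < x i) :
    Tendsto (fun i => N i * (x i - N i * Real.log (1 + x i / N i))) l (𝓝 (t ^ 2 / 2)) := by
  have hh : Tendsto (fun i => (N i)⁻¹) l (𝓝 0) := tendsto_inv_atTop_zero.comp hN
  have hu : Tendsto (fun i => x i / N i) l (𝓝 0) := by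
    simpa [div_eq_mul_inv] using hx.mul hh
  have hdiff : Tendsto (fun i => N i * (x i - N i * Real.log (1 + x i / N i)) - x i ^ 2 / 2) l
      (𝓝 0) := by
    refine squeeze_zero_norm' (a := fun i => 2 * x i ^ 3 * (N i)⁻¹) ?_ ?_
    · filter_upwards [hx0, hN.eventually_gt_atTop 0,
        hu.eventually (ge_mem_nhds (show (0 : ℝ) < 1 / 2 by norm_num))] with i h0 hNi hui
      have h := abs_log_one_add_sub_quadratic_le (div_nonneg h0.le hNi.le) hui
      have e : N i * (x i - N i * Real.log (1 + x i / N i)) - x i ^ 2 / 2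
          = N i ^ 2 * (x i / N i - Real.log (1 + x i / N i) - (x i / N i) ^ 2 / 2) := by
        field_simp
      rw [Real.norm_eq_abs, e, abs_mul, abs_of_nonneg (sq_nonneg _)]
      refine (mul_le_mul_of_nonneg_left h (sq_nonneg _)).trans_eq ?_
      field_simp
    · simpa using ((hx.pow 3).const_mul 2).mul hh
  simpa using hdiff.add ((hx.pow 2).div_const 2)

/-- If `N → ∞` and `N y → c` then `N (exp y - 1) → c`. -/
lemma tendsto_mul_exp_sub_one {ι : Type*} {l : Filter ι} {N y : ι → ℝ} {c : ℝ}
    (hN : Tendsto N l atTop) (hy : Tendsto (fun i => N i * y i) l (𝓝 c)) :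
    Tendsto (fun i => N i * (Real.exp (y i) - 1)) l (𝓝 c) := by
  have hh : Tendsto (fun i => (N i)⁻¹) l (𝓝 0) := tendsto_inv_atTop_zero.comp hN
  have hy0 : Tendsto y l (𝓝 0) := by
    have := hy.mul hh
    rw [mul_zero] at this
    refine this.congr' ?_
    filter_upwards [hN.eventually_gt_atTop 0] with i hi
    field_simp
  have hs : Tendsto (fun i => dslope Real.exp 0 (y i)) l (𝓝 1) := by
    have hc : ContinuousAt (dslope Real.exp 0) 0 :=
      continuousAt_dslope_same.2 Real.differentiableAt_exp
    have := hc.tendsto.comp hy0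
    simpa [dslope_same, Function.comp_def] using this
  have := hy.mul hs
  rw [mul_one] at this
  refine this.congr fun i => ?_
  have e := sub_smul_dslope Real.exp 0 (y i)
  simp only [sub_zero, smul_eq_mul, Real.exp_zero] at e
  rw [mul_assoc, e]

/-- Second-order expansion of the threshold `μ (1 + μ) ^ (N + b)`. -/
lemma tendsto_threshold_expansion {ι : Type*} {l : Filter ι} {N μ : ι → ℝ} {b t : ℝ}
    (ht0 : 0 < t) (ht : t ^ 2 + t - 1 = 0) (hN : Tendsto N l atTop)
    (hμ : ∀ᶠ i in l, 0 < μ i)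
    (heq : ∀ᶠ i in l,
      (N i + 1 + (N i + b) / (1 + μ i + (N i + b) * μ i)) * Real.log (1 + μ i) = 1) :
    Tendsto (fun i => N i ^ 2 * (μ i * (1 + μ i) ^ (N i + b)) - N i * (t * Real.exp t)) l
      (𝓝 (Real.exp t * ((1 + t) * (((2 + t) * t ^ 2 / 2 - (2 + b) * t ^ 2) / (2 * t + 1))
        + t * (b * t - t ^ 2 / 2)))) := by
  have hh : Tendsto (fun i => (N i)⁻¹) l (𝓝 0) := tendsto_inv_atTop_zero.comp hN
  set x : ι → ℝ := fun i => N i * μ i with hxdef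
  set q : ι → ℝ := fun i => N i * (x i - N i * Real.log (1 + μ i)) with hqdef
  set R : ι → ℝ := fun i => (1 + b) * x i + (2 + x i) * q i -
      (x i - (N i)⁻¹ * q i) * (1 + x i + (1 + b) * x i + b + (N i)⁻¹ * ((1 + b) * x i)) with hR
  have hx0 : ∀ᶠ i in l, 0 < x i := by
    filter_upwards [hμ, hN.eventually_gt_atTop 0] with i h1 h2 using mul_pos h2 h1
  have hxN : ∀ᶠ i in l, x i / N i = μ i := by
    filter_upwards [hN.eventually_gt_atTop 0] with i h
    simp only [hxdef]; field_simp
  have hquad : ∀ᶠ i in l, x i ^ 2 + x i - 1 = (N i)⁻¹ * R i := by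
    filter_upwards [hx0, hxN, heq, hN.eventually_gt_atTop 0, hN.eventually_gt_atTop (-b)]
      with i h0 h1 h2 h3 h4
    refine threshold_quadratic h3 h0 (by linarith) ?_
    have e : (x i - (N i)⁻¹ * q i) / N i = Real.log (1 + μ i) := by
      simp only [hqdef]
      field_simp
      ring
    rw [h1, e, h2]
  have hbd : ∀ᶠ i in l, 0 < x i ∧ x i ≤ 2 ∧ 0 ≤ q i ∧ q i ≤ 4 := by
    filter_upwards [hx0, hμ, heq, hN.eventually_ge_atTop 2, hN.eventually_gt_atTop (-b)]
      with i h0 h1 h2 h3 h4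
    have h5 : 0 < N i + b := by linarith
    exact ⟨h0, threshold_bounds h3 h1 (by positivity) h2⟩
  have bdd_mul : ∀ {f : ι → ℝ} {C : ℝ}, (∀ᶠ i in l, |f i| ≤ C) →
      Tendsto (fun i => (N i)⁻¹ * f i) l (𝓝 0) := fun {f C} hf =>
    hh.zero_mul_isBoundedUnder_le ⟨C, by simpa using hf⟩
  have hRbd : ∀ᶠ i in l, |R i| ≤ |1 + b| * 2 + 4 * 4 +
      (2 + 4) * (3 + |1 + b| * 2 + |b| + |1 + b| * 2) := by
    filter_upwards [hbd, hN.eventually_ge_atTop 1] with i ⟨h1, h2, h3, h4⟩ h5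
    have hi : (N i)⁻¹ ≤ 1 := inv_le_one_of_one_le₀ h5
    have hi0 : 0 ≤ (N i)⁻¹ := by positivity
    have hbx : |(1 + b) * x i| ≤ |1 + b| * 2 := by
      rw [abs_mul, abs_of_pos h1]; gcongr
    have hA : |x i - (N i)⁻¹ * q i| ≤ 2 + 4 := by
      have : (N i)⁻¹ * q i ≤ 1 * 4 := by gcongr
      have : 0 ≤ (N i)⁻¹ * q i := by positivity
      rw [abs_le]; constructor <;> linarith
    have hB : |(N i)⁻¹ * ((1 + b) * x i)| ≤ |1 + b| * 2 := by
      rw [abs_mul, abs_of_nonneg hi0]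
      calc _ ≤ 1 * (|1 + b| * 2) := by gcongr
        _ = _ := one_mul _
    have hC : |1 + x i + (1 + b) * x i + b + (N i)⁻¹ * ((1 + b) * x i)|
        ≤ 3 + |1 + b| * 2 + |b| + |1 + b| * 2 := by
      refine (abs_add_le _ _).trans (add_le_add ((abs_add_le _ _).trans (add_le_add
        ((abs_add_le _ _).trans (add_le_add ?_ hbx)) le_rfl)) hB)
      rw [abs_of_pos (by linarith)]; linarith
    have hD : |(2 + x i) * q i| ≤ 4 * 4 := by
      rw [abs_mul, abs_of_pos (by linarith), abs_of_nonneg h3]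
      gcongr; linarith
    refine (abs_sub _ _).trans (add_le_add ((abs_add_le _ _).trans (add_le_add hbx hD)) ?_)
    rw [abs_mul]
    gcongr
  have hfac : ∀ᶠ i in l, x i - t = (N i)⁻¹ * R i / (x i + t + 1) := by
    filter_upwards [hquad, hx0] with i h1 h2
    rw [eq_div_iff (by positivity), ← h1]
    linear_combination -ht
  have hx : Tendsto x l (𝓝 t) := by
    rw [← tendsto_sub_nhds_zero_iff]
    refine squeeze_zero_norm' (a := fun i => |(N i)⁻¹ * R i|) ?_
      (by simpa only [abs_zero] using (bdd_mul hRbd).abs)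
    filter_upwards [hfac, hx0] with i h1 h2
    rw [Real.norm_eq_abs, h1, abs_div, abs_of_pos (show 0 < x i + t + 1 by positivity)]
    exact div_le_self (abs_nonneg _) (by linarith)
  have hq : Tendsto q l (𝓝 (t ^ 2 / 2)) := by
    refine (tendsto_mul_sub_mul_log hN hx hx0).congr' ?_
    filter_upwards [hxN] with i h
    rw [h]
  have hRlim : Tendsto R l (𝓝 ((2 + t) * t ^ 2 / 2 - (2 + b) * t ^ 2)) := by
    have h1 := ((hx.const_mul (1 + b)).add ((hx.const_add 2).mul hq)).sub
      ((hx.sub (hh.mul hq)).mul (((((hx.const_add 1).add (hx.const_mul (1 + b))).add_const b)).add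
        (hh.mul (hx.const_mul (1 + b)))))
    convert h1 using 2
    ring
  have hNx : Tendsto (fun i => N i * (x i - t)) l
      (𝓝 (((2 + t) * t ^ 2 / 2 - (2 + b) * t ^ 2) / (2 * t + 1))) := by
    have h1 := hRlim.div ((hx.add_const t).add_const 1) (by positivity)
    rw [← two_mul] at h1
    refine h1.congr' ?_
    filter_upwards [hfac, hN.eventually_gt_atTop 0, hx0] with i h2 h3 h4
    rw [h2]
    simp only [Pi.div_apply]
    field_simp
  set d := ((2 + t) * t ^ 2 / 2 - (2 + b) * t ^ 2) / (2 * t + 1)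
  set y : ι → ℝ := fun i => (N i + b) * Real.log (1 + μ i) - t with hy
  have hNy : Tendsto (fun i => N i * y i) l (𝓝 (d - t ^ 2 / 2 + b * t)) := by
    have h1 := (hNx.sub hq).add ((hx.sub (hh.mul hq)).const_mul b)
    rw [zero_mul, sub_zero] at h1
    refine h1.congr' ?_
    filter_upwards [hN.eventually_gt_atTop 0] with i h2
    simp only [hy, hqdef]
    field_simp
    ring
  have h1 := (((hx.mul (tendsto_mul_exp_sub_one hN hNy)).add hNx).const_mul (Real.exp t))
  convert h1.congr' ?_ using 2
  · ring
  · filter_upwards [hμ] with i h2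
    have e : (1 + μ i) ^ (N i + b) = Real.exp t * Real.exp (y i) := by
      rw [Real.rpow_def_of_pos (by linarith), ← Real.exp_add]
      congr 1
      simp only [hy]
      ring
    rw [e]
    simp only [hxdef]
    ring


/-- With `τ = (√5−1)/2`, `σ_min(η) = σ(η−1)` and `σ_max(η) = σ(η+1)` (where `σ(β)` is the
unique `σ > 0` with `F(β,σ) = 1` for the parameter `η`), the width of the threshold
interval satisfies `(η+1)² · (σ_max(η) − σ_min(η)) → 2e^τ/(7+4τ)` as `η → ∞`, i.e.
`σ_max − σ_min ∼ (2e^τ/(7+4τ))·(η+1)^{−2}`. -/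
theorem threshold_interval_width (m : ℝ → ℝ → ℝ)
    (hm : ∀ β σ : ℝ, 0 ≤ β → 0 < σ →
      0 < m β σ ∧ m β σ * (1 + m β σ) ^ β = σ)
    (s : ℕ → ℝ → ℝ)
    (hs : ∀ η : ℕ, 2 ≤ η → ∀ β : ℝ, 0 < β →
      0 < s η β ∧ Ffun η m β (s η β) = 1)
    (τ : ℝ) (hτ : τ = (Real.sqrt 5 - 1) / 2) :
    Filter.Tendsto
      (fun η : ℕ => ((η : ℝ) + 1) ^ 2 * (s η ((η : ℝ) + 1) - s η ((η : ℝ) - 1)))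
      Filter.atTop (nhds (2 * Real.exp τ / (7 + 4 * τ))) := by
  have h5 : Real.sqrt 5 ^ 2 = 5 := Real.sq_sqrt (by norm_num)
  have hs5 : 1 < Real.sqrt 5 := by
    rw [Real.lt_sqrt (by norm_num)]; norm_num
  have hτ0 : 0 < τ := by rw [hτ]; linarith
  have hτ2 : τ ^ 2 + τ - 1 = 0 := by rw [hτ]; linear_combination h5 / 4
  have hN : Tendsto (fun η : ℕ => (η : ℝ) + 1) atTop atTop :=
    tendsto_atTop_add_const_right _ _ tendsto_natCast_atTop_atTop
  have key : ∀ b : ℝ, -2 ≤ b → Tendsto (fun η : ℕ => ((η : ℝ) + 1) ^ 2 * s η ((η : ℝ) + 1 + b)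
      - ((η : ℝ) + 1) * (τ * Real.exp τ)) atTop
      (𝓝 (Real.exp τ * ((1 + τ) * (((2 + τ) * τ ^ 2 / 2 - (2 + b) * τ ^ 2) / (2 * τ + 1))
        + τ * (b * τ - τ ^ 2 / 2)))) := by
    intro b hb
    have hpos : ∀ η : ℕ, 2 ≤ η → 0 < (η : ℝ) + 1 + b := fun η hη => by
      have : (2 : ℝ) ≤ η := by exact_mod_cast hη
      linarith
    refine (tendsto_threshold_expansion (b := b)
      (μ := fun η : ℕ => m ((η : ℝ) + 1 + b) (s η ((η : ℝ) + 1 + b))) hτ0 hτ2 hN ?_ ?_).congr' ?_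
    · filter_upwards [eventually_ge_atTop 2] with η hη
      exact (hm _ _ (hpos η hη).le (hs η hη _ (hpos η hη)).1).1
    · filter_upwards [eventually_ge_atTop 2] with η hη
      have h := (hs η hη _ (hpos η hη)).2
      rw [Ffun] at h
      rwa [show (η : ℝ) + 2 = η + 1 + 1 by ring] at h
    · filter_upwards [eventually_ge_atTop 2] with η hη
      rw [(hm _ _ (hpos η hη).le (hs η hη _ (hpos η hη)).1).2]
  have h := (key 0 (by norm_num)).sub (key (-2) le_rfl)
  convert h.congr fun η => ?_ using 2
  · field_simp
    linear_combination (-4 * (4 * τ ^ 2 + 3 * τ + 1)) * hτ2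
  · rw [show (η : ℝ) + 1 + 0 = η + 1 by ring, show (η : ℝ) + 1 + -2 = η - 1 by ring]
    ring
end

section
/- Let τ = (√5 − 1)/2 and for γ ∈ [−1,1] set α(γ) = ((5+2γ)τ + 1) / (2(2τ+1)). For real η > 0 and γ ∈ [−1,1], let μ(η,γ) be the unique positive solution μ of (η + 2 + (η+γ)/(1 + (1+η+γ)μ))·ln(1+μ) = 1, so that σ(η+γ) = μ(η,γ)·(1+μ(η,γ))^{η+γ}. Then there exist constants C > 0 and η₀ > 0 such that for all η ≥ η₀ and all γ ∈ [−1,1]: |τ/μ(η,γ) − (η + α(γ))| ≤ C/η. -/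
/-- The reciprocal of `log (1 + m)` agrees with `1 / m + 1 / 2` up to an error in `[0, 4 * m]`. -/
lemma inv_log_one_add_bounds {m : ℝ} (hm : 0 < m) (hm' : m ≤ 1 / 2) :
    0 ≤ 1 / m + 1 / 2 - 1 / Real.log (1 + m) ∧
      1 / m + 1 / 2 - 1 / Real.log (1 + m) ≤ 4 * m := by
  have hL : 0 < Real.log (1 + m) := Real.log_pos (by linarith)
  have hlow := Real.le_log_one_add_of_nonneg hm.le
  have hup : Real.log (1 + m) ≤ m - m ^ 2 / 2 + 2 * m ^ 3 := by
    have h := Real.abs_log_sub_add_sum_range_le (x := -m)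
      (by rw [abs_neg, abs_of_pos hm]; linarith) 2
    rw [abs_neg, abs_of_pos hm] at h
    have h2 : m ^ (2 + 1) / (1 - m) ≤ 2 * m ^ 3 := by
      rw [div_le_iff₀ (by linarith)]
      norm_num
      nlinarith [mul_nonneg (pow_pos hm 3).le (sub_nonneg.mpr hm')]
    have h3 := (abs_le.mp h).2
    norm_num [Finset.sum_range_succ] at h3 h2
    linarith
  constructor
  · have h : 1 / Real.log (1 + m) ≤ 1 / (2 * m / (m + 2)) :=
      one_div_le_one_div_of_le (by positivity) hlow
    have h' : 1 / (2 * m / (m + 2)) = 1 / m + 1 / 2 := by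
      field_simp
      ring
    linarith
  · have key : (1 / m + 1 / 2 - 4 * m) * Real.log (1 + m) ≤ 1 := by
      have hnn : 0 ≤ 1 / m + 1 / 2 - 4 * m := by
        have : 2 ≤ 1 / m := by
          rw [le_div_iff₀ hm]
          linarith
        linarith
      calc (1 / m + 1 / 2 - 4 * m) * Real.log (1 + m)
          ≤ (1 / m + 1 / 2 - 4 * m) * (m - m ^ 2 / 2 + 2 * m ^ 3) :=
            mul_le_mul_of_nonneg_left hup hnn
        _ = 1 + m ^ 2 * (-(9 / 4) + 3 * m - 8 * m ^ 2) := by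
            field_simp
            ring
        _ ≤ 1 := by
            have : m ^ 2 * (-(9 / 4) + 3 * m - 8 * m ^ 2) ≤ 0 :=
              mul_nonpos_of_nonneg_of_nonpos (by positivity) (by nlinarith)
            linarith
    have := (le_div_iff₀ hL).mpr key
    linarith

/-- If `v` solves the quadratic equation obtained from the defining equation of `μ` by writing
`v = τ / μ` and `r = 1 / μ + 1 / 2 - 1 / log (1 + μ)`, then `v` is close to `η + α(γ)`. -/
lemma abs_sub_le_of_quadratic {τ η γ v r : ℝ} (hτ : τ ^ 2 + τ = 1) (hτ₀ : 3 / 5 ≤ τ)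
    (hτ₁ : τ ≤ 31 / 50) (hη : 40 ≤ η) (hγ₀ : -1 ≤ γ) (hγ₁ : γ ≤ 1) (hv : 0 < v)
    (hr₀ : 0 ≤ r) (hr₁ : r * η ≤ 4)
    (hq : v ^ 2 + τ * v * (1 / 2 + γ - r - (1 + η + γ))
      - τ ^ 2 * (1 + η + γ + 1 / 2 - γ + r) * (1 + η + γ) = 0) :
    |v - (η + ((5 + 2 * γ) * τ + 1) / (2 * (2 * τ + 1)))| ≤ 100 / η := by
  set α := ((5 + 2 * γ) * τ + 1) / (2 * (2 * τ + 1)) with hα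
  have hαeq : α * (2 * (2 * τ + 1)) = (5 + 2 * γ) * τ + 1 := by
    rw [hα]
    field_simp
  obtain ⟨a, ha⟩ : ∃ a, a = α - 1 - γ := ⟨_, rfl⟩
  obtain ⟨e, he⟩ : ∃ e, e = v - (η + α) := ⟨_, rfl⟩
  have haeq : a * (2 * (2 * τ + 1)) = τ - 1 - 2 * γ * (τ + 1) := by
    rw [ha]
    linarith
  have ha₁ : a ≤ 1 := by nlinarith
  have ha₀ : -1 ≤ a := by nlinarith
  have hatau : a * (2 - τ) = 1 / 2 - γ - τ := by
    have h5 : a * (2 - τ) * (2 * (2 * τ + 1)) = (1 / 2 - γ - τ) * (2 * (2 * τ + 1)) := by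
      linear_combination (2 - τ) * haeq + (3 + 2 * γ) * hτ
    exact mul_right_cancel₀ (by positivity) h5
  have hr : r ≤ 1 / 10 := by nlinarith
  have hmain : e * (v + (1 + η + γ) * (1 - τ) + a + τ * (1 / 2 + γ - r))
      = r * (1 + η + γ) - a ^ 2 - τ * a * (1 / 2 + γ - r) := by
    have hv' : v = 1 + η + γ + a + e := by rw [he, ha]; ring
    rw [hv'] at hq ⊢
    linear_combination hq - (1 + η + γ) * hatau
      + ((1 + η + γ) ^ 2 + (1 + η + γ) * (1 / 2 - γ + r)) * hτ
  have hs₁ : τ * (1 / 2 + γ - r) ≤ 1 := by nlinarith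
  have hs₀ : -1 ≤ τ * (1 / 2 + γ - r) := by nlinarith
  have hfac : η / 4 ≤ v + (1 + η + γ) * (1 - τ) + a + τ * (1 / 2 + γ - r) := by
    have : η * (19 / 50) ≤ (1 + η + γ) * (1 - τ) :=
      mul_le_mul (by linarith) (by linarith) (by norm_num) (by linarith)
    linarith
  have hrhs : |r * (1 + η + γ) - a ^ 2 - τ * a * (1 / 2 + γ - r)| ≤ 25 := by
    have h1 : |a * (τ * (1 / 2 + γ - r))| ≤ 1 := by
      rw [abs_mul]
      exact mul_le_one₀ (abs_le.mpr ⟨ha₀, ha₁⟩) (abs_nonneg _) (abs_le.mpr ⟨hs₀, hs₁⟩)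
    obtain ⟨h2, h3⟩ := abs_le.mp h1
    have h4 : 0 ≤ r * (1 + η + γ) := mul_nonneg hr₀ (by linarith)
    have h5 : r * (1 + η + γ) ≤ 5 := by linarith [mul_le_mul_of_nonneg_left hγ₁ hr₀]
    have h6 : a ^ 2 ≤ 1 := (sq_le_one_iff_abs_le_one a).mpr (abs_le.mpr ⟨ha₀, ha₁⟩)
    have h7 : τ * a * (1 / 2 + γ - r) = a * (τ * (1 / 2 + γ - r)) := by ring
    rw [abs_le, h7]
    constructor <;> linarith [sq_nonneg a]
  rw [← he, le_div_iff₀ (by linarith)]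
  rw [← hmain, abs_mul] at hrhs
  have := mul_le_mul_of_nonneg_left (hfac.trans (le_abs_self _)) (abs_nonneg e)
  linarith


/-- With `τ = (√5−1)/2` and `α(γ) = ((5+2γ)τ + 1)/(2(2τ+1))` for `γ ∈ [−1,1]`: if
`μ(η,γ)` is the unique positive solution of
`(η + 2 + (η+γ)/(1 + (1+η+γ)μ))·ln(1+μ) = 1`, then there exist `C > 0` and `η₀ > 0`
such that for all `η ≥ η₀` and all `γ ∈ [−1,1]`,
`|τ/μ(η,γ) − (η + α(γ))| ≤ C/η`. -/
theorem mu_asymptotics (τ : ℝ) (hτ : τ = (Real.sqrt 5 - 1) / 2)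
    (mu : ℝ → ℝ → ℝ)
    (hmu : ∀ η : ℝ, 0 < η → ∀ γ ∈ Set.Icc (-1 : ℝ) 1,
      0 < mu η γ ∧
      (η + 2 + (η + γ) / (1 + (1 + η + γ) * mu η γ)) * Real.log (1 + mu η γ) = 1) :
    ∃ C > 0, ∃ η₀ > 0, ∀ η : ℝ, η₀ ≤ η → ∀ γ ∈ Set.Icc (-1 : ℝ) 1,
      |τ / mu η γ - (η + ((5 + 2 * γ) * τ + 1) / (2 * (2 * τ + 1)))| ≤ C / η := by
  have h5 : Real.sqrt 5 ^ 2 = 5 := Real.sq_sqrt (by norm_num)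
  have h5₀ : 11 / 5 ≤ Real.sqrt 5 := Real.le_sqrt_of_sq_le (by norm_num)
  have h5₁ : Real.sqrt 5 ≤ 56 / 25 := Real.sqrt_le_iff.mpr (by norm_num)
  refine ⟨100, by norm_num, 40, by norm_num, fun η hη γ hγ => ?_⟩
  obtain ⟨hm, heq⟩ := hmu η (by linarith) γ hγ
  obtain ⟨hγ₀, hγ₁⟩ := hγ
  generalize mu η γ = m at hm heq ⊢
  have hL : 0 < Real.log (1 + m) := Real.log_pos (by linarith)
  have hD : 0 < 1 + (1 + η + γ) * m := by
    have := mul_pos (by linarith : 0 < 1 + η + γ) hm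
    linarith
  have hinv : 1 / Real.log (1 + m) = η + 2 + (η + γ) / (1 + (1 + η + γ) * m) := by
    rw [div_eq_iff hL.ne', heq]
  have hquot : 0 ≤ (η + γ) / (1 + (1 + η + γ) * m) := div_nonneg (by linarith) hD.le
  have hmη : m * η ≤ 1 := by
    have hlow := Real.le_log_one_add_of_nonneg hm.le
    have h1 : η * Real.log (1 + m) + 2 * Real.log (1 + m) ≤ 1 := by
      nlinarith [mul_nonneg hquot hL.le]
    rw [div_le_iff₀ (by linarith)] at hlow
    nlinarith
  obtain ⟨hr₀, hr₁⟩ := inv_log_one_add_bounds hm (by nlinarith)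
  obtain ⟨r, hr⟩ : ∃ r, r = 1 / m + 1 / 2 - 1 / Real.log (1 + m) := ⟨_, rfl⟩
  rw [← hr] at hr₀ hr₁
  rw [hinv] at hr
  refine abs_sub_le_of_quadratic (r := r) (by rw [hτ]; linarith) (by linarith) (by linarith) hη
    hγ₀ hγ₁ (div_pos (by linarith) hm) hr₀ (by nlinarith) ?_
  obtain ⟨u, hu⟩ : ∃ u, u = 1 / m := ⟨_, rfl⟩
  obtain ⟨q, hq⟩ : ∃ q, q = (η + γ) / (1 + (1 + η + γ) * m) := ⟨_, rfl⟩
  have hum : u * m = 1 := by rw [hu, one_div_mul_cancel hm.ne']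
  have hqu : q * (u + (1 + η + γ)) = (η + γ) * u := by
    have hqD : q * (1 + (1 + η + γ) * m) = η + γ := by rw [hq, div_mul_cancel₀ _ hD.ne']
    linear_combination u * hqD - q * (1 + η + γ) * hum
  rw [← hu, ← hq] at hr
  rw [div_eq_mul_one_div, ← hu, hr]
  linear_combination τ ^ 2 * hqu
end

section
/- Fix a real σ > 0. Then sup_{β ≥ 0} θ(β,η,σ) = (1/(η+2))·(1 + O(1/ln(η+1))) as the integer η → ∞; precisely, there exist C > 0 and η₀ such that for all integers η ≥ η₀, |(η+2)·sup_{β ≥ 0} θ(β,η,σ) − 1| ≤ C/ln(η+1). -/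
/-- Eliminating `σ` through `σ = μ (1 + μ) ^ β` in the throughput. -/
theorem thetaB_eq_s16 {η : ℕ} {m : ℝ → ℝ → ℝ} {σ β : ℝ} (hpos : 0 < m β σ)
    (heq : m β σ * (1 + m β σ) ^ β = σ) :
    thetaB η m σ β =
      m β σ * (1 + m β σ) ^ (2 * β - fR η β) / (1 + (β + 1) * m β σ) := by
  have hl : 0 < 1 + m β σ := by linarith
  have hexp : (1 + m β σ) ^ (2 * β - fR η β) =
      (1 + m β σ) ^ β * (1 + m β σ) ^ (β - fR η β) := by
    rw [← Real.rpow_add hl]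
    congr 1
    ring
  have hden : (β + 1) * (1 + m β σ) - β = 1 + (β + 1) * m β σ := by ring
  rw [thetaB, hden, hexp, ← mul_assoc, heq]

theorem thetaB_le {η : ℕ} (hη : 1 ≤ η) {m : ℝ → ℝ → ℝ} {σ β : ℝ} (hβ : 0 ≤ β)
    (hpos : 0 < m β σ) (heq : m β σ * (1 + m β σ) ^ β = σ) :
    thetaB η m σ β ≤ 1 / (η : ℝ) := by
  have hη' : (1 : ℝ) ≤ η := by exact_mod_cast hη
  rw [thetaB_eq_s16 hpos heq]
  generalize m β σ = μ at hpos
  have hl : 0 < 1 + μ := by linarith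
  have hden : 0 < 1 + (β + 1) * μ := by positivity
  rw [div_le_div_iff₀ hden (by linarith), one_mul]
  by_cases h1 : β ≤ (η : ℝ) - 1
  · have hf : fR η β = 2 * (η : ℝ) := by simp [fR, h1]
    have hneg : 2 * β - fR η β = -(2 * ((η : ℝ) - β)) := by rw [hf]; ring
    rw [hneg, Real.rpow_neg hl.le]
    have hb : 1 + 2 * ((η : ℝ) - β) * μ ≤ (1 + μ) ^ (2 * ((η : ℝ) - β)) :=
      one_add_mul_self_le_rpow_one_add (by linarith) (by linarith)
    have hp : 0 < (1 + μ) ^ (2 * ((η : ℝ) - β)) := Real.rpow_pos_of_pos hl _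
    rw [← div_eq_mul_inv, div_mul_eq_mul_div, div_le_iff₀ hp]
    have hprod := mul_le_mul_of_nonneg_left hb hden.le
    have hnn : 0 ≤ (β + 1) * μ * (2 * ((η : ℝ) - β) * μ) := by
      have : 0 ≤ (η : ℝ) - β := by linarith
      positivity
    have hlin : 0 ≤ ((η : ℝ) - β + 1) * μ := by
      have : 0 ≤ (η : ℝ) - β + 1 := by linarith
      positivity
    nlinarith
  · have hle : 2 * β - fR η β ≤ 0 := by
      unfold fR
      split_ifs <;> linarith
    have hpow : (1 + μ) ^ (2 * β - fR η β) ≤ 1 :=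
      Real.rpow_le_one_of_one_le_of_nonpos (by linarith) hle
    have hmul : μ * (1 + μ) ^ (2 * β - fR η β) * η ≤ μ * 1 * η := by gcongr
    nlinarith

/-- A positive solution of `μ (1 + μ) ^ β = σ` is at least of order `log β / β`. -/
theorem log_le_of_mul_one_add_rpow_eq {σ β μ : ℝ} (hβ : 0 ≤ β) (hμ : 0 < μ)
    (heq : μ * (1 + μ) ^ β = σ) :
    Real.log (β + 1) ≤ 2 * ((β + 1) * μ) - Real.log σ := by
  have hN : 0 < β + 1 := by linarith
  have hlog := congrArg Real.log heq
  rw [Real.log_mul hμ.ne' (Real.rpow_pos_of_pos (by linarith) _).ne',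
    Real.log_rpow (by linarith)] at hlog
  have h1 : Real.log (1 + μ) ≤ μ := by
    linarith [Real.log_le_sub_one_of_pos (show 0 < 1 + μ by linarith)]
  have h2 : Real.log (β + 1) + Real.log μ ≤ (β + 1) * μ := by
    rw [← Real.log_mul hN.ne' hμ.ne']
    linarith [Real.log_le_sub_one_of_pos (mul_pos hN hμ)]
  nlinarith [mul_le_mul_of_nonneg_left h1 hβ]

/-- For fixed `σ > 0`, the maximal throughput satisfies
`sup_{β ≥ 0} θ(β,η,σ) = (1/(η+2))·(1 + O(1/ln(η+1)))` as `η → ∞`: there exist `C > 0`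
and `η₀` such that for all integers `η ≥ η₀`,
`|(η+2)·sup_{β ≥ 0} θ(β,η,σ) − 1| ≤ C/ln(η+1)`. -/
theorem max_throughput_asymptotics (σ : ℝ) (hσ : 0 < σ) (m : ℝ → ℝ → ℝ)
    (hm : ∀ β σ' : ℝ, 0 ≤ β → 0 < σ' →
      0 < m β σ' ∧ m β σ' * (1 + m β σ') ^ β = σ') :
    ∃ C > 0, ∃ η₀ : ℕ, ∀ η : ℕ, η₀ ≤ η →
      |((η : ℝ) + 2) * sSup (thetaB η m σ '' Set.Ici 0) - 1| ≤
        C / Real.log ((η : ℝ) + 1) := by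
  refine ⟨2 + |Real.log σ|, by positivity, 1, fun η hη => ?_⟩
  have hη' : (1 : ℝ) ≤ η := by exact_mod_cast hη
  have hL : 0 < Real.log ((η : ℝ) + 1) := Real.log_pos (by linarith)
  have hub : ∀ y ∈ thetaB η m σ '' Set.Ici 0, y ≤ 1 / (η : ℝ) := by
    rintro _ ⟨β, hβ, rfl⟩
    obtain ⟨hpos, heq⟩ := hm β σ hβ hσ
    exact thetaB_le hη hβ hpos heq
  have hmem : ((η : ℝ) + 1) ∈ Set.Ici (0 : ℝ) := Set.mem_Ici.2 (by linarith)
  have hup : sSup (thetaB η m σ '' Set.Ici 0) ≤ 1 / (η : ℝ) :=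
    csSup_le ⟨_, Set.mem_image_of_mem _ hmem⟩ hub
  have hlow : thetaB η m σ ((η : ℝ) + 1) ≤ sSup (thetaB η m σ '' Set.Ici 0) :=
    le_csSup ⟨_, hub⟩ (Set.mem_image_of_mem _ hmem)
  obtain ⟨hpos, heq⟩ := hm ((η : ℝ) + 1) σ hmem hσ
  have hf : fR η ((η : ℝ) + 1) = 2 * ((η : ℝ) + 1) := by
    have : ¬ (η : ℝ) + 1 ≤ (η : ℝ) - 1 := by linarith
    rw [fR, if_neg this, if_pos le_rfl]
    ring
  rw [thetaB_eq_s16 hpos heq, hf, sub_self, Real.rpow_zero, mul_one] at hlow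
  have hlog := log_le_of_mul_one_add_rpow_eq hmem hpos heq
  generalize m ((η : ℝ) + 1) σ = μ at hpos hlow hlog
  have hmono : Real.log ((η : ℝ) + 1) ≤ Real.log ((η : ℝ) + 1 + 1) :=
    Real.log_le_log (by linarith) (by linarith)
  have hden : 0 < 1 + ((η : ℝ) + 1 + 1) * μ := by positivity
  rw [abs_le]
  constructor
  · have hgap : 1 / (1 + ((η : ℝ) + 1 + 1) * μ) ≤
        (2 + |Real.log σ|) / Real.log ((η : ℝ) + 1) := by
      rw [div_le_div_iff₀ hden hL]
      have habs := neg_abs_le (Real.log σ)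
      have hnn : 0 ≤ |Real.log σ| * (((η : ℝ) + 1 + 1) * μ) := by positivity
      nlinarith
    have hmul := mul_le_mul_of_nonneg_left hlow (show 0 ≤ (η : ℝ) + 2 by linarith)
    have hval : ((η : ℝ) + 2) * (μ / (1 + ((η : ℝ) + 1 + 1) * μ)) =
        1 - 1 / (1 + ((η : ℝ) + 1 + 1) * μ) := by
      field_simp
      ring
    linarith
  · have hmul := mul_le_mul_of_nonneg_left hup (show 0 ≤ (η : ℝ) + 2 by linarith)
    have hval : ((η : ℝ) + 2) * (1 / (η : ℝ)) = 1 + 2 / η := by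
      field_simp
    have hlogle : Real.log ((η : ℝ) + 1) ≤ η := by
      linarith [Real.log_le_sub_one_of_pos (show 0 < (η : ℝ) + 1 by linarith)]
    have hfin : 2 / (η : ℝ) ≤ (2 + |Real.log σ|) / Real.log ((η : ℝ) + 1) := by
      gcongr
      linarith [abs_nonneg (Real.log σ)]
    linarith
end

section
/- Fix an integer η ≥ 1 and a real β with 0 ≤ β ≤ η. Then θ(β,η,σ) → 0 as σ → ∞. -/
/-- For `0 ≤ β ≤ η` the exponent `2β - f(β)` is at most `-1`. -/
theorem two_mul_sub_fR_le_neg_one {η : ℕ} {β : ℝ} (hβη : β ≤ (η : ℝ)) :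
    2 * β - fR η β ≤ -1 := by
  unfold fR
  split_ifs <;> linarith

/-- If `μ(1+μ)^β = σ`, then `σ^{1/(β+1)} ≤ 1 + μ`. -/
theorem rpow_inv_le_one_add {β μ σ : ℝ} (hβ0 : 0 ≤ β) (hμ : 0 < μ) (hσ : 0 ≤ σ)
    (h : μ * (1 + μ) ^ β = σ) : σ ^ (β + 1)⁻¹ ≤ 1 + μ := by
  rw [Real.rpow_inv_le_iff_of_pos hσ (by linarith) (by linarith),
    Real.rpow_add_one (by linarith), ← h, mul_comm]
  gcongr
  linarith

/-- If `m β σ = μ` solves `μ(1+μ)^β = σ` and `0 ≤ β ≤ η`, then `0 ≤ θ ≤ (1+μ)⁻¹`. -/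
theorem thetaB_mem_Icc {η : ℕ} {m : ℝ → ℝ → ℝ} {σ β : ℝ} (hβ0 : 0 ≤ β) (hβη : β ≤ (η : ℝ))
    (hμ : 0 < m β σ) (h : m β σ * (1 + m β σ) ^ β = σ) :
    thetaB η m σ β ∈ Set.Icc 0 (1 + m β σ)⁻¹ := by
  unfold thetaB
  generalize m β σ = μ at hμ h
  subst h
  have hl : 0 < 1 + μ := by linarith
  have hβμ : 0 ≤ β * μ := by positivity
  have hd : 0 < (β + 1) * (1 + μ) - β := by nlinarith
  refine ⟨by positivity, ?_⟩
  rw [div_le_iff₀ hd, mul_assoc, ← Real.rpow_add hl]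
  have hp : (1 + μ) ^ (β + (β - fR η β)) ≤ (1 + μ)⁻¹ := by
    rw [← Real.rpow_neg_one]
    exact Real.rpow_le_rpow_of_exponent_le (by linarith)
      (by linarith [two_mul_sub_fR_le_neg_one hβη])
  calc μ * (1 + μ) ^ (β + (β - fR η β)) ≤ μ * (1 + μ)⁻¹ := by gcongr
    _ ≤ (1 + μ)⁻¹ * ((β + 1) * (1 + μ) - β) := by
      rw [mul_comm]
      gcongr
      linarith

/-- For a fixed real `β` with `0 ≤ β ≤ η`, the throughput `θ(β,η,σ)` tends to `0` as
`σ → ∞`. -/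
theorem theta_vanishes_small_beta (η : ℕ) (hη : 1 ≤ η) (β : ℝ)
    (hβ0 : 0 ≤ β) (hβη : β ≤ (η : ℝ)) (m : ℝ → ℝ → ℝ)
    (hm : ∀ b σ : ℝ, 0 ≤ b → 0 < σ →
      0 < m b σ ∧ m b σ * (1 + m b σ) ^ b = σ) :
    Filter.Tendsto (fun σ : ℝ => thetaB η m σ β) Filter.atTop (nhds 0) := by
  have hlim : Filter.Tendsto (fun σ : ℝ => (σ ^ (β + 1)⁻¹)⁻¹) Filter.atTop (nhds 0) :=
    (tendsto_rpow_atTop (by positivity)).inv_tendsto_atTop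
  refine tendsto_of_tendsto_of_tendsto_of_le_of_le' tendsto_const_nhds hlim ?_ ?_
  · filter_upwards [Filter.eventually_gt_atTop 0] with σ hσ
    obtain ⟨hμ, h⟩ := hm β σ hβ0 hσ
    exact (thetaB_mem_Icc hβ0 hβη hμ h).1
  · filter_upwards [Filter.eventually_gt_atTop 0] with σ hσ
    obtain ⟨hμ, h⟩ := hm β σ hβ0 hσ
    exact (thetaB_mem_Icc hβ0 hβη hμ h).2.trans
      (inv_anti₀ (by positivity) (rpow_inv_le_one_add hβ0 hμ hσ.le h))
end

section
/- Fix an integer β ≥ 1 and set ξ(β) = β^β/(β+1)^{β+1}. Consider the power series S(σ) = 1 + Σ_{l=1}^∞ ((−1)^{l−1} (βl)_{l−1} / l!)·σ^l, where (x)_n denotes the ascending Pochhammer symbol (x)_n = x(x+1)⋯(x+n−1). Then: (a) for every real σ with 0 < σ ≤ ξ(β) the series converges absolutely and its sum equals λ₀(σ), the unique positive real root of λ^{β+1} − λ^β − σ = 0; (b) for every real σ > ξ(β) the series diverges. -/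
/-- The coefficient `a_l = (−1)^{l−1} (βl)_{l−1} / l!` of the series
`S(σ) = 1 + Σ_{l=1}^∞ a_l σ^l`, re-indexed so that `seriesCoeff β l = a_{l+1}`;
`(x)_n` is the ascending Pochhammer symbol. -/
noncomputable def seriesCoeff (β : ℕ) (l : ℕ) : ℝ :=
  (-1 : ℝ) ^ l * Polynomial.eval ((β : ℝ) * (l + 1)) (ascPochhammer ℝ l) /
    (Nat.factorial (l + 1))

open Filter Topology

theorem Nat.ascFactorial_succ_mul_descFactorial (m k j : ℕ) :
    (m + 1).ascFactorial k * m.descFactorial j = (m + k).descFactorial (k + j) := by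
  induction j with
  | zero => simp [Nat.add_descFactorial_eq_ascFactorial]
  | succ j ih =>
    rw [← add_assoc, Nat.descFactorial_succ, Nat.descFactorial_succ, ← ih,
      show m + k - (k + j) = m - j by omega]
    ring

theorem Nat.ascFactorial_succ_mul_succ_descFactorial (m k j N : ℕ) (h : k + j = N + 1) :
    (m + 1).ascFactorial k * (m + 1).descFactorial j =
      (m + 1) * (m + k).descFactorial N := by
  cases j with
  | zero =>
    obtain rfl : k = N + 1 := by omega
    rw [← Nat.add_descFactorial_eq_ascFactorial, show m + (N + 1) = (m + N) + 1 by omega,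
      Nat.descFactorial_zero, mul_one, Nat.descFactorial_succ,
      show m + N + 1 - N = m + 1 by omega]
  | succ j =>
    obtain rfl : N = k + j := by omega
    rw [Nat.succ_descFactorial_succ, ← Nat.ascFactorial_succ_mul_descFactorial]
    ring

theorem seriesCoeff_eq (β k : ℕ) :
    seriesCoeff β k =
      (-1) ^ k * (((β * (k + 1)).ascFactorial k : ℕ) : ℝ) / ((k + 1).factorial : ℝ) := by
  rw [seriesCoeff, ← ascPochhammer_nat_eq_ascFactorial, ascPochhammer_eval_cast]
  push_cast
  rfl

theorem Polynomial.sum_range_neg_one_pow_mul_choose_mul_eval (P : Polynomial ℝ) {n : ℕ}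
    (hP : P.natDegree < n) :
    ∑ k ∈ Finset.range (n + 1), (-1 : ℝ) ^ k * n.choose k * P.eval (k : ℝ) = 0 := by
  have h := congrFun (Polynomial.fwdDiff_iter_eq_zero_of_degree_lt hP) 0
  rw [fwdDiff_iter_eq_sum_shift] at h
  have h2 : ∑ k ∈ Finset.range (n + 1), (-1 : ℝ) ^ k * n.choose k * P.eval (k : ℝ) =
      (-1) ^ n * ∑ k ∈ Finset.range (n + 1),
        ((-1 : ℤ) ^ (n - k) * n.choose k) • P.eval (0 + k • (1 : ℝ)) := by
    rw [Finset.mul_sum]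
    refine Finset.sum_congr rfl fun k hk => ?_
    have hk : k ≤ n := by simpa [Nat.lt_succ_iff] using hk
    obtain ⟨j, rfl⟩ := Nat.exists_eq_add_of_le hk
    have hj : (-1 : ℝ) ^ j * (-1) ^ j = 1 := by rw [← mul_pow]; simp
    simp only [add_tsub_cancel_left, zsmul_eq_mul, zero_add, nsmul_eq_mul, mul_one, pow_add]
    push_cast
    linear_combination (-(-1 : ℝ) ^ k * ((k + j).choose k) * P.eval (k : ℝ)) * hj
  rw [h2, h]
  simp

theorem seriesCoeff_mul_choose (β : ℕ) (hβ : 1 ≤ β) (N k j : ℕ) (h : k + j = N + 1) :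
    seriesCoeff β k * ((β * (k + 1)).choose j : ℝ) * ((N + 2).factorial : ℝ) =
      (-1) ^ k * β * ((N + 2).choose (k + 1)) * ((k + 1 : ℕ) *
        (descPochhammer ℝ N).eval (((β : ℝ) + 1) * ((k + 1 : ℕ) : ℝ) - 2)) := by
  obtain ⟨m, hm⟩ : ∃ m, β * (k + 1) = m + 1 :=
    Nat.exists_eq_succ_of_ne_zero (by positivity)
  have hmR : (β : ℝ) * (k + 1) = m + 1 := by exact_mod_cast hm
  have harg : ((β : ℝ) + 1) * ((k + 1 : ℕ) : ℝ) - 2 = ((m + k : ℕ) : ℝ) := by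
    push_cast
    linear_combination hmR
  rw [harg, descPochhammer_eval_eq_descFactorial, seriesCoeff_eq, hm]
  have h1 : (((m + 1).ascFactorial k : ℕ) : ℝ) * (j.factorial * (m + 1).choose j : ℕ) =
      (m + 1) * (m + k).descFactorial N := by
    rw [← Nat.descFactorial_eq_factorial_mul_choose]
    exact_mod_cast Nat.ascFactorial_succ_mul_succ_descFactorial m k j N h
  have h2 : ((N + 2).choose (k + 1) : ℝ) * (k + 1).factorial * j.factorial =
      (N + 2).factorial := by
    have := Nat.choose_mul_factorial_mul_factorial (n := N + 2) (k := k + 1) (by omega)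
    rw [show N + 2 - (k + 1) = j by omega] at this
    exact_mod_cast this
  have h3 : ((k + 1).factorial : ℝ) ≠ 0 := by positivity
  rw [← h2]
  field_simp
  push_cast at h1 ⊢
  linear_combination ((N + 2).choose (k + 1) : ℝ) * h1 -
    ((N + 2).choose (k + 1) : ℝ) * ((m + k).descFactorial N) * hmR

theorem sum_antidiagonal_seriesCoeff_mul_choose (β : ℕ) (hβ : 1 ≤ β) (N : ℕ) :
    ∑ p ∈ Finset.HasAntidiagonal.antidiagonal (N + 1),
      seriesCoeff β p.1 * ((β * (p.1 + 1)).choose p.2 : ℝ) = 0 := by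
  let P : Polynomial ℝ := Polynomial.X * (descPochhammer ℝ N).comp
    (Polynomial.C ((β : ℝ) + 1) * Polynomial.X - Polynomial.C 2)
  have hP : P.natDegree < N + 2 := by
    have h1 : (Polynomial.C ((β : ℝ) + 1) * Polynomial.X - Polynomial.C 2).natDegree ≤ 1 := by
      compute_degree
    have h2 := Polynomial.natDegree_mul_le (p := (Polynomial.X : Polynomial ℝ))
      (q := (descPochhammer ℝ N).comp
        (Polynomial.C ((β : ℝ) + 1) * Polynomial.X - Polynomial.C 2))
    rw [Polynomial.natDegree_comp, descPochhammer_natDegree, Polynomial.natDegree_X] at h2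
    have h3 := Nat.mul_le_mul_left N h1
    change P.natDegree ≤ _ at h2
    omega
  have h := Polynomial.sum_range_neg_one_pow_mul_choose_mul_eval P hP
  rw [Finset.sum_range_succ'] at h
  have hf : ((N + 2).factorial : ℝ) ≠ 0 := by positivity
  refine (mul_eq_zero.mp ?_).resolve_right hf
  rw [Finset.sum_mul]
  have h4 : ∀ p ∈ Finset.HasAntidiagonal.antidiagonal (N + 1),
      seriesCoeff β p.1 * ((β * (p.1 + 1)).choose p.2 : ℝ) * ((N + 2).factorial : ℝ) =
      -β * ((-1) ^ (p.1 + 1) * ((N + 2).choose (p.1 + 1)) * P.eval ((p.1 + 1 : ℕ) : ℝ)) := by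
    intro p hp
    rw [seriesCoeff_mul_choose β hβ N p.1 p.2 (Finset.HasAntidiagonal.mem_antidiagonal.mp hp)]
    simp only [P, Polynomial.eval_mul, Polynomial.eval_X, Polynomial.eval_comp,
      Polynomial.eval_sub, Polynomial.eval_C]
    ring
  rw [Finset.sum_congr rfl h4, ← Finset.mul_sum,
    Finset.Nat.sum_antidiagonal_eq_sum_range_succ_mk]
  simp only [P, Polynomial.eval_mul, Polynomial.eval_X, Nat.cast_zero, zero_mul, mul_zero,
    add_zero] at h ⊢
  rw [h, mul_zero]

theorem hasSum_seriesCoeff_mul_pow (β : ℕ) (hβ : 1 ≤ β) (w : ℝ) (hw : 0 ≤ w)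
    (hs : Summable fun k : ℕ => |seriesCoeff β k * (w * (1 + w) ^ β) ^ (k + 1)|) :
    HasSum (fun k : ℕ => seriesCoeff β k * (w * (1 + w) ^ β) ^ (k + 1)) w := by
  let F : ℕ × ℕ → ℝ := fun p =>
    seriesCoeff β p.1 * ((β * (p.1 + 1)).choose p.2 : ℝ) * w ^ (p.1 + 1 + p.2)
  have hrow : ∀ k : ℕ, HasSum (fun j : ℕ => ((β * (k + 1)).choose j : ℝ) * w ^ (k + 1 + j))
      ((w * (1 + w) ^ β) ^ (k + 1)) := by
    intro k
    have h : (w * (1 + w) ^ β) ^ (k + 1) = ∑ j ∈ Finset.range (β * (k + 1) + 1),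
        ((β * (k + 1)).choose j : ℝ) * w ^ (k + 1 + j) := by
      rw [mul_pow, ← pow_mul, add_comm 1 w, add_pow, Finset.mul_sum]
      refine Finset.sum_congr rfl fun j _ => ?_
      rw [one_pow, pow_add]
      ring
    rw [h]
    refine hasSum_sum_of_ne_finset_zero fun j hj => ?_
    rw [Nat.choose_eq_zero_of_lt (by simpa using hj)]
    simp
  have hF : Summable F := by
    refine Summable.of_abs ((summable_prod_of_nonneg fun p => abs_nonneg _).2 ?_)
    have habs : ∀ k j : ℕ, |F (k, j)| =
        |seriesCoeff β k| * (((β * (k + 1)).choose j : ℝ) * w ^ (k + 1 + j)) := by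
      intro k j
      simp only [F]
      rw [mul_assoc, abs_mul, abs_of_nonneg (a := _ * _ ^ _) (by positivity)]
    have hr : ∀ k : ℕ, HasSum (fun j : ℕ => |F (k, j)|)
        |seriesCoeff β k * (w * (1 + w) ^ β) ^ (k + 1)| := by
      intro k
      simp only [habs]
      rw [abs_mul, abs_of_nonneg (a := _ ^ (k + 1)) (by positivity)]
      exact (hrow k).mul_left _
    refine ⟨fun k => (hr k).summable, ?_⟩
    simpa only [fun k => (hr k).tsum_eq] using hs
  have hdiag : HasSum F w := by
    have h1 := hF.hasSum
    rw [← Finset.HasAntidiagonal.sigmaAntidiagonalEquivProd.hasSum_iff] at h1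
    have h2 := h1.sigma fun n => hasSum_fintype _
    have h3 : ∀ n : ℕ, ∑ p : Finset.HasAntidiagonal.antidiagonal n,
        (F ∘ Finset.HasAntidiagonal.sigmaAntidiagonalEquivProd) ⟨n, p⟩ =
          if n = 0 then w else 0 := by
      intro n
      have h4 : ∑ p : Finset.HasAntidiagonal.antidiagonal n,
          (F ∘ Finset.HasAntidiagonal.sigmaAntidiagonalEquivProd) ⟨n, p⟩ =
            (∑ p ∈ Finset.HasAntidiagonal.antidiagonal n,
              seriesCoeff β p.1 * ((β * (p.1 + 1)).choose p.2 : ℝ)) * w ^ (n + 1) := by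
        rw [Finset.sum_mul, ← Finset.sum_coe_sort (Finset.HasAntidiagonal.antidiagonal n)]
        refine Finset.sum_congr rfl fun p _ => ?_
        have hp := Finset.HasAntidiagonal.mem_antidiagonal.mp p.2
        simp only [Function.comp, Finset.HasAntidiagonal.sigmaAntidiagonalEquivProd_apply, F]
        rw [show p.1.1 + 1 + p.1.2 = n + 1 by omega]
      rw [h4]
      cases n with
      | zero => simp [seriesCoeff]
      | succ N => rw [sum_antidiagonal_seriesCoeff_mul_choose β hβ]; simp
    simp only [h3] at h2
    have h5 := h2.unique (hasSum_ite_eq 0 w)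
    have h6 := hF.hasSum
    rw [← Finset.HasAntidiagonal.sigmaAntidiagonalEquivProd.hasSum_iff] at h6
    rw [← Finset.HasAntidiagonal.sigmaAntidiagonalEquivProd.hasSum_iff]
    rwa [h5] at h6
  refine hdiag.prod_fiberwise fun k => ?_
  simpa only [F, mul_assoc] using (hrow k).mul_left (seriesCoeff β k)

theorem abs_seriesCoeff_mul_factorial (β : ℕ) (hβ : 1 ≤ β) (k : ℕ) :
    |seriesCoeff β k| * (((β : ℝ) + 1) * (((β : ℝ) + 1) * (k + 1) - 1) *
      ((β * (k + 1)).factorial * (k + 1).factorial)) =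
        β * ((β + 1) * (k + 1)).factorial := by
  obtain ⟨m, hm⟩ : ∃ m, β * (k + 1) = m + 1 :=
    Nat.exists_eq_succ_of_ne_zero (by positivity)
  have hmR : (β : ℝ) * (k + 1) = m + 1 := by exact_mod_cast hm
  have h1 : (β + 1) * (k + 1) = m + k + 1 + 1 := by linarith
  have h2 : (m.factorial : ℝ) * (m + 1).ascFactorial k = (m + k).factorial := by
    exact_mod_cast Nat.factorial_mul_ascFactorial m k
  rw [seriesCoeff_eq, hm, h1, Nat.factorial_succ m, Nat.factorial_succ (m + k + 1),
    Nat.factorial_succ (m + k), abs_div, abs_mul, abs_pow, abs_neg, abs_one, one_pow, one_mul,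
    Nat.abs_cast, Nat.abs_cast]
  have h3 : ((k + 1).factorial : ℝ) ≠ 0 := by positivity
  field_simp
  push_cast
  rw [← h2, show ((β : ℝ) + 1) * (k + 1) - 1 = m + k + 1 by linear_combination hmR,
    show (m : ℝ) + k + 1 + 1 = (β + 1) * (k + 1) by linear_combination -hmR, ← hmR]
  ring

theorem Stirling.factorial_eq_stirlingSeq_mul (n : ℕ) (hn : n ≠ 0) :
    (n.factorial : ℝ) = stirlingSeq n * (√(2 * n : ℝ) * (n / Real.exp 1) ^ n) := by
  have : (0 : ℝ) < n := by positivity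
  rw [stirlingSeq, div_mul_cancel₀ _ (by positivity)]

open Stirling in
theorem abs_seriesCoeff_mul_pow_eq (β : ℕ) (hβ : 1 ≤ β) (k : ℕ) :
    |seriesCoeff β k| * ((β : ℝ) ^ β / ((β : ℝ) + 1) ^ (β + 1)) ^ (k + 1) *
      ((((β : ℝ) + 1) * (k + 1) - 1) * √((k : ℝ) + 1)) =
    stirlingSeq ((β + 1) * (k + 1)) / (stirlingSeq (β * (k + 1)) * stirlingSeq (k + 1)) *
      (β / (β + 1) * (√((β : ℝ) + 1) / (√2 * √(β : ℝ)))) := by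
  have hfac := abs_seriesCoeff_mul_factorial β hβ k
  have hb : (0 : ℝ) < β := by positivity
  have hs : ∀ n : ℕ, n ≠ 0 → 0 < stirlingSeq n := by
    intro n hn
    obtain ⟨m, rfl⟩ := Nat.exists_eq_succ_of_ne_zero hn
    exact stirlingSeq'_pos m
  have hs1 := hs (β * (k + 1)) (by positivity)
  have hs2 := hs (k + 1) (by positivity)
  rw [factorial_eq_stirlingSeq_mul (β * (k + 1)) (by positivity),
    factorial_eq_stirlingSeq_mul (k + 1) (by positivity),
    factorial_eq_stirlingSeq_mul ((β + 1) * (k + 1)) (by positivity)] at hfac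
  push_cast at hfac
  generalize stirlingSeq ((β + 1) * (k + 1)) = s at *
  generalize stirlingSeq (β * (k + 1)) = s1 at *
  generalize stirlingSeq (k + 1) = s2 at *
  generalize |seriesCoeff β k| = a at *
  have hl : (0 : ℝ) < (k : ℝ) + 1 := by positivity
  have he : (0 : ℝ) < Real.exp 1 := Real.exp_pos 1
  rw [Real.sqrt_mul (by norm_num), Real.sqrt_mul hb.le, Real.sqrt_mul (by norm_num),
    Real.sqrt_mul (by norm_num), Real.sqrt_mul (by positivity)] at hfac
  have hpow : ((((β : ℝ) + 1) * (k + 1)) / Real.exp 1) ^ ((β + 1) * (k + 1)) *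
      ((β : ℝ) ^ β / ((β : ℝ) + 1) ^ (β + 1)) ^ (k + 1) =
      (β * (k + 1) / Real.exp 1) ^ (β * (k + 1)) * ((k + 1) / Real.exp 1) ^ (k + 1) := by
    simp only [pow_mul, ← mul_pow]
    congr 1
    simp only [div_pow, mul_pow]
    field_simp
    ring
  set A := (β * ((k : ℝ) + 1) / Real.exp 1) ^ (β * (k + 1))
  set B := (((k : ℝ) + 1) / Real.exp 1) ^ (k + 1)
  set D := ((((β : ℝ) + 1) * (k + 1)) / Real.exp 1) ^ ((β + 1) * (k + 1))
  set X := ((β : ℝ) ^ β / ((β : ℝ) + 1) ^ (β + 1)) ^ (k + 1)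
  have hA0 : 0 < A := by positivity
  have hB0 : 0 < B := by positivity
  have h2 : 0 < √(2 : ℝ) := by positivity
  have hq1 : 0 < √(β : ℝ) := by positivity
  have hq2 : 0 < √((k : ℝ) + 1) := by positivity
  have hq3 : 0 < √((β : ℝ) + 1) := by positivity
  field_simp
  refine mul_right_cancel₀ (b := A * B * √2 * √((k : ℝ) + 1)) (by positivity) ?_
  linear_combination X * hfac + β * s * √2 * √((β : ℝ) + 1) * √((k : ℝ) + 1) * hpow

theorem exists_tendsto_abs_seriesCoeff_mul_pow (β : ℕ) (hβ : 1 ≤ β) :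
    ∃ K : ℝ, 0 < K ∧ Tendsto (fun k : ℕ =>
      |seriesCoeff β k| * ((β : ℝ) ^ β / ((β : ℝ) + 1) ^ (β + 1)) ^ (k + 1) *
        ((((β : ℝ) + 1) * (k + 1) - 1) * √((k : ℝ) + 1))) atTop (𝓝 K) := by
  have hb : (0 : ℝ) < β := by positivity
  have hpi : 0 < √Real.pi := Real.sqrt_pos.2 Real.pi_pos
  refine ⟨√Real.pi / (√Real.pi * √Real.pi) *
      (β / (β + 1) * (√((β : ℝ) + 1) / (√2 * √(β : ℝ)))), by positivity, ?_⟩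
  simp only [abs_seriesCoeff_mul_pow_eq β hβ]
  have h : ∀ c : ℕ, 1 ≤ c →
      Tendsto (fun k : ℕ => Stirling.stirlingSeq (c * (k + 1))) atTop (𝓝 (√Real.pi)) := by
    intro c hc
    refine Stirling.tendsto_stirlingSeq_sqrt_pi.comp (tendsto_atTop_mono (fun k => ?_) tendsto_id)
    simp only [id]
    nlinarith
  have h1 := h 1 le_rfl
  simp only [one_mul] at h1
  exact ((h (β + 1) (by omega)).div ((h β hβ).mul h1) (by positivity)).mul_const _

theorem summable_abs_seriesCoeff_mul_pow (β : ℕ) (hβ : 1 ≤ β) :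
    Summable fun k : ℕ =>
      |seriesCoeff β k| * ((β : ℝ) ^ β / ((β : ℝ) + 1) ^ (β + 1)) ^ (k + 1) := by
  obtain ⟨K, -, hK⟩ := exists_tendsto_abs_seriesCoeff_mul_pow β hβ
  have hb : (1 : ℝ) ≤ β := by exact_mod_cast hβ
  have hsum : Summable fun k : ℕ => (K + 1) * (1 / ((k + 1 : ℕ) : ℝ) ^ (3 / 2 : ℝ)) :=
    ((summable_nat_add_iff 1).2
      (Real.summable_one_div_nat_rpow.2 (by norm_num : (1 : ℝ) < 3 / 2))).mul_left _
  refine hsum.of_norm_bounded_eventually_nat ?_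
  filter_upwards [hK.eventually (gt_mem_nhds (lt_add_one K))] with k hk
  have hl : (0 : ℝ) < (k : ℝ) + 1 := by positivity
  rw [Real.norm_of_nonneg (by positivity), mul_one_div, le_div_iff₀ (by positivity)]
  refine le_trans (mul_le_mul_of_nonneg_left ?_ (by positivity)) hk.le
  rw [show (3 / 2 : ℝ) = 1 + 1 / 2 by norm_num, Real.rpow_add (by positivity), Real.rpow_one,
    ← Real.sqrt_eq_rpow]
  push_cast
  gcongr
  nlinarith

theorem not_summable_seriesCoeff_mul_pow (β : ℕ) (hβ : 1 ≤ β) (σ : ℝ)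
    (hσ : (β : ℝ) ^ β / ((β : ℝ) + 1) ^ (β + 1) < σ) :
    ¬ Summable (fun k : ℕ => seriesCoeff β k * σ ^ (k + 1)) := by
  intro hs
  obtain ⟨K, hK0, hK⟩ := exists_tendsto_abs_seriesCoeff_mul_pow β hβ
  have hb : (1 : ℝ) ≤ β := by exact_mod_cast hβ
  set ξ := (β : ℝ) ^ β / ((β : ℝ) + 1) ^ (β + 1)
  have hξ : 0 < ξ := by positivity
  have hσ0 : 0 < σ := hξ.trans hσ
  have hterm := hs.tendsto_atTop_zero.abs
  have hr : ξ / σ < 1 := (div_lt_one hσ0).2 hσ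
  have hgeo := ((tendsto_add_atTop_iff_nat 1).2
    (tendsto_pow_const_mul_const_pow_of_abs_lt_one 2
      (by rwa [abs_of_pos (by positivity)] : |ξ / σ| < 1))).const_mul ((β : ℝ) + 1)
  have hprod := hterm.mul hgeo
  rw [abs_zero, zero_mul] at hprod
  refine hK0.ne' (tendsto_nhds_unique hK (squeeze_zero (fun k => ?_) (fun k => ?_) hprod))
  · have : (0 : ℝ) ≤ ((β : ℝ) + 1) * (k + 1) - 1 := by nlinarith [k.cast_nonneg (α := ℝ)]
    positivity
  · have hl : (1 : ℝ) ≤ (k : ℝ) + 1 := by linarith [k.cast_nonneg (α := ℝ)]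
    have hsq : √((k : ℝ) + 1) ≤ (k : ℝ) + 1 := Real.sqrt_le_iff.2 ⟨by positivity, by nlinarith⟩
    have h1 : (((β : ℝ) + 1) * (k + 1) - 1) * √((k : ℝ) + 1) ≤
        ((β : ℝ) + 1) * ((k : ℝ) + 1) ^ 2 := by
      rw [sq, ← mul_assoc]
      gcongr
      linarith
    calc _ ≤ |seriesCoeff β k| * ξ ^ (k + 1) * (((β : ℝ) + 1) * ((k : ℝ) + 1) ^ 2) := by gcongr
      _ = _ := by
        have h2 : ξ ^ (k + 1) = σ ^ (k + 1) * (ξ / σ) ^ (k + 1) := by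
          rw [← mul_pow, mul_div_cancel₀ _ hσ0.ne']
        rw [abs_mul, abs_of_pos (a := σ ^ (k + 1)) (by positivity), h2]
        push_cast
        ring

/-- Let `ξ(β) = β^β/(β+1)^{β+1}` and consider
`S(σ) = 1 + Σ_{l=1}^∞ ((−1)^{l−1}(βl)_{l−1}/l!)·σ^l`. Then (a) for `0 < σ ≤ ξ(β)` the
series converges absolutely and `S(σ) = λ₀(σ)`, the unique positive real root of
`λ^{β+1} − λ^β − σ = 0`; (b) for `σ > ξ(β)` the series diverges. -/
theorem lambda0_series_expansion (β : ℕ) (hβ : 1 ≤ β) :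
    (∀ σ : ℝ, 0 < σ → σ ≤ (β : ℝ) ^ β / ((β : ℝ) + 1) ^ (β + 1) →
      Summable (fun l : ℕ => |seriesCoeff β l * σ ^ (l + 1)|) ∧
      ∀ lam0 : ℝ, 0 < lam0 → lam0 ^ (β + 1) - lam0 ^ β - σ = 0 →
        1 + ∑' l : ℕ, seriesCoeff β l * σ ^ (l + 1) = lam0) ∧
    (∀ σ : ℝ, (β : ℝ) ^ β / ((β : ℝ) + 1) ^ (β + 1) < σ →
      ¬ Summable (fun l : ℕ => seriesCoeff β l * σ ^ (l + 1))) := by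
  refine ⟨fun σ hσ hσξ => ?_, not_summable_seriesCoeff_mul_pow β hβ⟩
  have hs : Summable fun l : ℕ => |seriesCoeff β l * σ ^ (l + 1)| := by
    refine (summable_abs_seriesCoeff_mul_pow β hβ).of_nonneg_of_le (fun l => abs_nonneg _)
      fun l => ?_
    rw [abs_mul, abs_of_pos (a := σ ^ (l + 1)) (by positivity)]
    gcongr
  refine ⟨hs, fun lam0 hpos hroot => ?_⟩
  have hσw : σ = (lam0 - 1) * (1 + (lam0 - 1)) ^ β := by
    rw [add_sub_cancel, sub_one_mul, ← pow_succ']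
    linarith
  have hw : 0 ≤ lam0 - 1 := by
    rw [add_sub_cancel] at hσw
    exact (pos_of_mul_pos_left (hσw ▸ hσ) (by positivity)).le
  rw [hσw] at hs ⊢
  rw [(hasSum_seriesCoeff_mul_pow β hβ _ hw hs).tsum_eq]
  ring
end
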